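/- Let A be a Hopf algebra over a field k and let (H, ·, ∘) be a cocommutative Hopf brace over k. Suppose (A, H, ▷, ◁) is a matched pair of Hopf algebras (with respect to the multiplication · on H) and (A, ▶) is a left H∘-module bialgebra (where H∘ denotes the Hopf algebra (H, ∘)) such that for all a ∈ A and x, x' ∈ H: (i) x ▶ (x' ▷ a) = ((x₍₁₎ ∘ x')·S(x₍₂₎)) ▷ (x₍₃₎ ▶ a), and (ii) x ∘ (x' ◁ a) = (((x₍₁₎ ∘ x')·S(x₍₂₎)) ◁ (x₍₃₎ ▶ a))·x₍₄₎, where S is the antipode of (H, ·). Then the tensor product coalgebra A ⊗ H, equipped with the two multiplications (a ⊗ x)(b ⊗ y) = a(x₍₁₎ ▷ b₍₁₎) ⊗ (x₍₂₎ ◁ b₍₂₎)·y and (a ⊗ x) ∘ (b ⊗ y) = a(x₍₁₎ ▶ b) ⊗ x₍₂₎ ∘ y, is a Hopf brace. -/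

import Mathlib

/-! Common definitions for formalizing "Constructing Hopf braces" (Agore). -/

open TensorProduct LinearMap

namespace HopfBraceNL

universe u

variable (k : Type u) [Field k]

section HopfStr

variable (V : Type u) [AddCommGroup V] [Module k V] [Coalgebra k V]

/-- The coalgebra `V` is cocommutative. -/
def IsCocomm : Prop :=
  (TensorProduct.comm k V V).toLinearMap ∘ₗ (Coalgebra.comul (R := k) (A := V)) =
    Coalgebra.comul (R := k) (A := V)

/-- A Hopf algebra structure on the underlying coalgebra of `V`: a multiplication, unit and
antipode making `V` a Hopf algebra whose comultiplication and counit are the given ones. -/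
structure HopfStr where
  mul : V ⊗[k] V →ₗ[k] V
  one : V
  mul_assoc : ∀ a b c : V, mul (mul (a ⊗ₜ[k] b) ⊗ₜ[k] c) = mul (a ⊗ₜ[k] mul (b ⊗ₜ[k] c))
  one_mul : ∀ a : V, mul (one ⊗ₜ[k] a) = a
  mul_one : ∀ a : V, mul (a ⊗ₜ[k] one) = a
  comul_mul : ∀ a b : V,
    Coalgebra.comul (R := k) (mul (a ⊗ₜ[k] b)) =
      TensorProduct.map mul mul
        (TensorProduct.tensorTensorTensorComm k V V V V
          (Coalgebra.comul (R := k) a ⊗ₜ[k] Coalgebra.comul (R := k) b))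
  counit_mul : ∀ a b : V,
    Coalgebra.counit (R := k) (mul (a ⊗ₜ[k] b)) =
      Coalgebra.counit (R := k) a * Coalgebra.counit (R := k) b
  comul_one : Coalgebra.comul (R := k) one = one ⊗ₜ[k] one
  counit_one : Coalgebra.counit (R := k) one = 1
  antipode : V →ₗ[k] V
  antipode_left :
    mul ∘ₗ rTensor V antipode ∘ₗ Coalgebra.comul =
      toSpanSingleton k V one ∘ₗ Coalgebra.counit
  antipode_right :
    mul ∘ₗ lTensor V antipode ∘ₗ Coalgebra.comul =
      toSpanSingleton k V one ∘ₗ Coalgebra.counit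

variable {k V}

/-- The Hopf structure is commutative. -/
def HopfStr.IsComm (hs : HopfStr k V) : Prop :=
  ∀ x y : V, hs.mul (x ⊗ₜ[k] y) = hs.mul (y ⊗ₜ[k] x)

/-- The linear map `x ⊗ y ⊗ z ↦ (x₍₁₎ ∘ y)·S(x₍₂₎)·(x₍₃₎ ∘ z)` (Sweedler notation), the right
hand side of the Hopf brace compatibility condition, written point-free.  Here `m` and `S` are
the multiplication and antipode of the first Hopf structure and `m'` the multiplication of the
second one. -/
noncomputable def braceRHS (m : V ⊗[k] V →ₗ[k] V) (S : V →ₗ[k] V)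
    (m' : V ⊗[k] V →ₗ[k] V) : V ⊗[k] (V ⊗[k] V) →ₗ[k] V :=
  m ∘ₗ lTensor V m
    ∘ₗ TensorProduct.map m' (TensorProduct.map S m')
    ∘ₗ lTensor (V ⊗[k] V) (TensorProduct.assoc k V V V).toLinearMap
    ∘ₗ (TensorProduct.tensorTensorTensorComm k V (V ⊗[k] V) V V).toLinearMap
    ∘ₗ rTensor (V ⊗[k] V)
        ((lTensor V (Coalgebra.comul (R := k))) ∘ₗ (Coalgebra.comul (R := k) (A := V)))

variable (k V) in
/-- A Hopf brace on the coalgebra `V`: two Hopf algebra structures subject to the compatibility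
`x ∘ (y·z) = (x₍₁₎ ∘ y)·S(x₍₂₎)·(x₍₃₎ ∘ z)`. -/
structure HopfBrace where
  dot : HopfStr k V
  circ : HopfStr k V
  brace : circ.mul ∘ₗ lTensor V dot.mul = braceRHS dot.mul dot.antipode circ.mul

/-- A solution of the braid equation on `V ⊗ V`. -/
def SolvesBraid {W : Type u} [AddCommGroup W] [Module k W]
    (c : W ⊗[k] W →ₗ[k] W ⊗[k] W) : Prop :=
  letI c₁ : (W ⊗[k] W) ⊗[k] W →ₗ[k] (W ⊗[k] W) ⊗[k] W := rTensor W c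
  letI c₂ : (W ⊗[k] W) ⊗[k] W →ₗ[k] (W ⊗[k] W) ⊗[k] W :=
    (TensorProduct.assoc k W W W).symm.toLinearMap ∘ₗ lTensor W c ∘ₗ
      (TensorProduct.assoc k W W W).toLinearMap
  c₁ ∘ₗ c₂ ∘ₗ c₁ = c₂ ∘ₗ c₁ ∘ₗ c₂

end HopfStr

section Actions

variable {k}
variable {A H : Type u}
  [AddCommGroup A] [Module k A] [Coalgebra k A]
  [AddCommGroup H] [Module k H] [Coalgebra k H]

/-- `(x, a) ↦ (x₍₁₎ ⊗ a₍₁₎) ⊗ (x₍₂₎ ⊗ a₍₂₎)`, as an element. -/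
noncomputable def split (x : H) (a : A) : (H ⊗[k] A) ⊗[k] (H ⊗[k] A) :=
  TensorProduct.tensorTensorTensorComm k H H A A
    (Coalgebra.comul (R := k) x ⊗ₜ[k] Coalgebra.comul (R := k) a)

/-- `A` is a left module over the Hopf structure `hH` via `act`. -/
structure IsLeftModule (hH : HopfStr k H) (act : H ⊗[k] A →ₗ[k] A) : Prop where
  one_act : ∀ a : A, act (hH.one ⊗ₜ[k] a) = a
  mul_act : ∀ (x y : H) (a : A),
    act (hH.mul (x ⊗ₜ[k] y) ⊗ₜ[k] a) = act (x ⊗ₜ[k] act (y ⊗ₜ[k] a))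

/-- `A` is a left module over `hH`-op via `act`, i.e. `(xy) ▶ a = y ▶ (x ▶ a)`. -/
structure IsLeftOpModule (hH : HopfStr k H) (act : H ⊗[k] A →ₗ[k] A) : Prop where
  one_act : ∀ a : A, act (hH.one ⊗ₜ[k] a) = a
  mul_act : ∀ (x y : H) (a : A),
    act (hH.mul (x ⊗ₜ[k] y) ⊗ₜ[k] a) = act (y ⊗ₜ[k] act (x ⊗ₜ[k] a))

/-- The measuring conditions: `x ▶ (ab) = (x₍₁₎ ▶ a)(x₍₂₎ ▶ b)` and `x ▶ 1 = ε(x)1`. -/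
structure IsModuleAlgebraLaw (hA : HopfStr k A) (act : H ⊗[k] A →ₗ[k] A) : Prop where
  act_mul : ∀ (x : H) (a b : A),
    act (x ⊗ₜ[k] hA.mul (a ⊗ₜ[k] b)) =
      hA.mul (TensorProduct.map act act
        (TensorProduct.tensorTensorTensorComm k H H A A
          (Coalgebra.comul (R := k) x ⊗ₜ[k] (a ⊗ₜ[k] b))))
  act_one : ∀ x : H, act (x ⊗ₜ[k] hA.one) = Coalgebra.counit (R := k) x • hA.one

/-- `act` is a coalgebra map: `Δ(x ▶ a) = (x₍₁₎ ▶ a₍₁₎) ⊗ (x₍₂₎ ▶ a₍₂₎)`,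
`ε(x ▶ a) = ε(x)ε(a)`. -/
structure IsCoalgebraLaw (act : H ⊗[k] A →ₗ[k] A) : Prop where
  comul_act : ∀ (x : H) (a : A),
    Coalgebra.comul (R := k) (act (x ⊗ₜ[k] a)) = TensorProduct.map act act (split x a)
  counit_act : ∀ (x : H) (a : A),
    Coalgebra.counit (R := k) (act (x ⊗ₜ[k] a)) =
      Coalgebra.counit (R := k) x * Coalgebra.counit (R := k) a

/-- `(A, act)` is a left `hH`-module algebra. -/
structure IsLeftModuleAlgebra (hH : HopfStr k H) (hA : HopfStr k A)
    (act : H ⊗[k] A →ₗ[k] A) : Prop where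
  toIsLeftModule : IsLeftModule hH act
  toLaw : IsModuleAlgebraLaw hA act

/-- `(A, act)` is a left `hH`-module coalgebra. -/
structure IsLeftModuleCoalgebra (hH : HopfStr k H) (act : H ⊗[k] A →ₗ[k] A) : Prop where
  toIsLeftModule : IsLeftModule hH act
  toCoalgLaw : IsCoalgebraLaw act

/-- `(A, act)` is a left `hH`-module bialgebra. -/
structure IsLeftModuleBialgebra (hH : HopfStr k H) (hA : HopfStr k A)
    (act : H ⊗[k] A →ₗ[k] A) : Prop where
  toIsLeftModule : IsLeftModule hH act
  toLaw : IsModuleAlgebraLaw hA act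
  toCoalgLaw : IsCoalgebraLaw act

/-- `(A, act)` is a left `hH`-op-module bialgebra. -/
structure IsLeftOpModuleBialgebra (hH : HopfStr k H) (hA : HopfStr k A)
    (act : H ⊗[k] A →ₗ[k] A) : Prop where
  toIsLeftOpModule : IsLeftOpModule hH act
  toLaw : IsModuleAlgebraLaw hA act
  toCoalgLaw : IsCoalgebraLaw act

/-- `H` is a right module over the Hopf structure `hA` via `ract : H ⊗ A → H`. -/
structure IsRightModule (hA : HopfStr k A) (ract : H ⊗[k] A →ₗ[k] H) : Prop where
  act_one : ∀ x : H, ract (x ⊗ₜ[k] hA.one) = x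
  act_mul : ∀ (x : H) (a b : A),
    ract (x ⊗ₜ[k] hA.mul (a ⊗ₜ[k] b)) = ract (ract (x ⊗ₜ[k] a) ⊗ₜ[k] b)

/-- `ract` is a coalgebra map `H ⊗ A → H`. -/
structure IsRightCoalgebraLaw (ract : H ⊗[k] A →ₗ[k] H) : Prop where
  comul_act : ∀ (x : H) (a : A),
    Coalgebra.comul (R := k) (ract (x ⊗ₜ[k] a)) = TensorProduct.map ract ract (split x a)
  counit_act : ∀ (x : H) (a : A),
    Coalgebra.counit (R := k) (ract (x ⊗ₜ[k] a)) =
      Coalgebra.counit (R := k) x * Coalgebra.counit (R := k) a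

/-- `(H, ract)` is a right `hA`-module bialgebra:  in addition to the module and coalgebra
conditions, `(xy) ◁ a = (x ◁ a₍₁₎)(y ◁ a₍₂₎)` and `1 ◁ a = ε(a)1`. -/
structure IsRightModuleBialgebra (hA : HopfStr k A) (hH : HopfStr k H)
    (ract : H ⊗[k] A →ₗ[k] H) : Prop where
  toIsRightModule : IsRightModule hA ract
  mul_ract : ∀ (x y : H) (a : A),
    ract (hH.mul (x ⊗ₜ[k] y) ⊗ₜ[k] a) =
      hH.mul (TensorProduct.map ract ract
        (TensorProduct.tensorTensorTensorComm k H H A A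
          ((x ⊗ₜ[k] y) ⊗ₜ[k] Coalgebra.comul (R := k) a)))
  one_ract : ∀ a : A, ract (hH.one ⊗ₜ[k] a) = Coalgebra.counit (R := k) a • hH.one
  toCoalgLaw : IsRightCoalgebraLaw ract

/-- `(A, H, tri, quad)` is a matched pair of Hopf algebras. -/
structure IsMatchedPair (hA : HopfStr k A) (hH : HopfStr k H)
    (tri : H ⊗[k] A →ₗ[k] A) (quad : H ⊗[k] A →ₗ[k] H) : Prop where
  tri_module : IsLeftModule hH tri
  tri_coalg : IsCoalgebraLaw tri
  quad_module : IsRightModule hA quad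
  quad_coalg : IsRightCoalgebraLaw quad
  mp1 : ∀ x : H, tri (x ⊗ₜ[k] hA.one) = Coalgebra.counit (R := k) x • hA.one
  mp1' : ∀ a : A, quad (hH.one ⊗ₜ[k] a) = Coalgebra.counit (R := k) a • hH.one
  mp2 : ∀ (x : H) (a b : A),
    tri (x ⊗ₜ[k] hA.mul (a ⊗ₜ[k] b)) =
      hA.mul (lTensor A tri (TensorProduct.assoc k A H A
        ((TensorProduct.map tri quad (split x a)) ⊗ₜ[k] b)))
  mp3 : ∀ (x y : H) (a : A),
    quad (hH.mul (x ⊗ₜ[k] y) ⊗ₜ[k] a) =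
      hH.mul (rTensor H quad ((TensorProduct.assoc k H A H).symm
        (x ⊗ₜ[k] TensorProduct.map tri quad (split y a))))
  mp4 : ∀ (x : H) (a : A),
    TensorProduct.map quad tri (split x a) =
      TensorProduct.comm k A H (TensorProduct.map tri quad (split x a))

variable (k) in
/-- `(a ⊗ (u₁ ⊗ u₂)) ⊗ y ↦ mA (a ⊗ u₁) ⊗ mH (u₂ ⊗ y)`: the standard way to assemble
a multiplication on `A ⊗ H` from a middle term `u ∈ A ⊗ H`. -/
noncomputable def sandwich (mA : A ⊗[k] A →ₗ[k] A) (mH : H ⊗[k] H →ₗ[k] H) :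
    (A ⊗[k] (A ⊗[k] H)) ⊗[k] H →ₗ[k] A ⊗[k] H :=
  TensorProduct.map mA mH
    ∘ₗ (TensorProduct.assoc k (A ⊗[k] A) H H).toLinearMap
    ∘ₗ rTensor H (TensorProduct.assoc k A A H).symm.toLinearMap

variable (k) in
/-- `(m ⊗ n) ⊗ p ↦ (m ⊗ p) ⊗ n`. -/
noncomputable def rightComm (M N P : Type u) [AddCommGroup M] [Module k M]
    [AddCommGroup N] [Module k N] [AddCommGroup P] [Module k P] :
    (M ⊗[k] N) ⊗[k] P →ₗ[k] (M ⊗[k] P) ⊗[k] N :=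
  (TensorProduct.assoc k M P N).symm.toLinearMap
    ∘ₗ lTensor M (TensorProduct.comm k N P).toLinearMap
    ∘ₗ (TensorProduct.assoc k M N P).toLinearMap

/-- `(x, b) ↦ (x₍₁₎ ▷ b₍₁₎) ⊗ (x₍₂₎ ◁ b₍₂₎)`. -/
noncomputable def matchedEl (tri : H ⊗[k] A →ₗ[k] A) (quad : H ⊗[k] A →ₗ[k] H)
    (x : H) (b : A) : A ⊗[k] H :=
  TensorProduct.map tri quad (split x b)

/-- `(x, b) ↦ (x₍₁₎ ▷ b) ⊗ x₍₂₎`. -/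
noncomputable def smashEl (tri : H ⊗[k] A →ₗ[k] A) (x : H) (b : A) : A ⊗[k] H :=
  rTensor H tri (rightComm k H H A (Coalgebra.comul (R := k) x ⊗ₜ[k] b))

/-- `(x, b) ↦ b₍₁₎ ⊗ (x ◁ b₍₂₎)`. -/
noncomputable def rsmashEl (ract : H ⊗[k] A →ₗ[k] H) (x : H) (b : A) : A ⊗[k] H :=
  lTensor A ract (TensorProduct.leftComm k H A A (x ⊗ₜ[k] Coalgebra.comul (R := k) b))

end Actions


section Convolution

variable {k}
variable {C D E : Type u} [AddCommGroup C] [Module k C] [Coalgebra k C]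
  [AddCommGroup D] [Module k D] [Coalgebra k D]
  [AddCommGroup E] [Module k E] [Coalgebra k E]
variable {M N P Q R T : Type u} [AddCommGroup M] [Module k M] [AddCommGroup N] [Module k N]
  [AddCommGroup P] [Module k P] [AddCommGroup Q] [Module k Q] [AddCommGroup R] [Module k R]
  [AddCommGroup T] [Module k T]

/-- The convolution `c ↦ m (f c₍₁₎ ⊗ g c₍₂₎)` of two linear maps along a pairing `m`. -/
noncomputable def conv (m : M ⊗[k] N →ₗ[k] P) (f : C →ₗ[k] M) (g : C →ₗ[k] N) : C →ₗ[k] P :=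
  m ∘ₗ TensorProduct.map f g ∘ₗ Coalgebra.comul

theorem conv_apply (m : M ⊗[k] N →ₗ[k] P) (f : C →ₗ[k] M) (g : C →ₗ[k] N) (c : C) :
    conv m f g c = m (TensorProduct.map f g (Coalgebra.comul (R := k) c)) := rfl

theorem comp_conv (h : P →ₗ[k] Q) (m : M ⊗[k] N →ₗ[k] P) (f : C →ₗ[k] M) (g : C →ₗ[k] N) :
    h ∘ₗ conv m f g = conv (h ∘ₗ m) f g := rfl

theorem conv_comp_comp (m : M ⊗[k] N →ₗ[k] P) (p : Q →ₗ[k] M) (q : R →ₗ[k] N)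
    (f : C →ₗ[k] Q) (g : C →ₗ[k] R) :
    conv m (p ∘ₗ f) (q ∘ₗ g) = conv (m ∘ₗ TensorProduct.map p q) f g := by
  simp only [conv, TensorProduct.map_comp, LinearMap.comp_assoc]

theorem conv_comp_left (m : M ⊗[k] N →ₗ[k] P) (p : Q →ₗ[k] M)
    (f : C →ₗ[k] Q) (g : C →ₗ[k] N) :
    conv m (p ∘ₗ f) g = conv (m ∘ₗ rTensor N p) f g :=
  conv_comp_comp m p LinearMap.id f g

theorem conv_comp_right (m : M ⊗[k] N →ₗ[k] P) (q : R →ₗ[k] N)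
    (f : C →ₗ[k] M) (g : C →ₗ[k] R) :
    conv m f (q ∘ₗ g) = conv (m ∘ₗ lTensor M q) f g :=
  conv_comp_comp m LinearMap.id q f g

theorem conv_zero_left (m : M ⊗[k] N →ₗ[k] P) (g : C →ₗ[k] N) : conv m 0 g = 0 := by
  simp [conv]

theorem conv_zero_right (m : M ⊗[k] N →ₗ[k] P) (f : C →ₗ[k] M) : conv m f 0 = 0 := by
  simp [conv]

theorem conv_add_left (m : M ⊗[k] N →ₗ[k] P) (f f' : C →ₗ[k] M) (g : C →ₗ[k] N) :
    conv m (f + f') g = conv m f g + conv m f' g := by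
  simp only [conv, TensorProduct.map_add_left, LinearMap.add_comp, LinearMap.comp_add]

theorem conv_add_right (m : M ⊗[k] N →ₗ[k] P) (f : C →ₗ[k] M) (g g' : C →ₗ[k] N) :
    conv m f (g + g') = conv m f g + conv m f g' := by
  simp only [conv, TensorProduct.map_add_right, LinearMap.add_comp, LinearMap.comp_add]

theorem conv_assoc {m₁ : P ⊗[k] Q →ₗ[k] R} {m₂ : M ⊗[k] N →ₗ[k] P}
    {m₃ : M ⊗[k] T →ₗ[k] R} {m₄ : N ⊗[k] Q →ₗ[k] T}
    (h : ∀ a b c, m₁ (m₂ (a ⊗ₜ b) ⊗ₜ c) = m₃ (a ⊗ₜ m₄ (b ⊗ₜ c)))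
    (e : C →ₗ[k] M) (f : C →ₗ[k] N) (g : C →ₗ[k] Q) :
    conv m₁ (conv m₂ e f) g = conv m₃ e (conv m₄ f g) := by
  have hl : conv m₁ (conv m₂ e f) g =
      m₁ ∘ₗ TensorProduct.map (m₂ ∘ₗ TensorProduct.map e f) g ∘ₗ
        rTensor C Coalgebra.comul ∘ₗ Coalgebra.comul := by
    rw [← LinearMap.comp_assoc (Coalgebra.comul (R := k)), rTensor, ← TensorProduct.map_comp]
    rfl
  have hr : conv m₃ e (conv m₄ f g) =
      m₃ ∘ₗ TensorProduct.map e (m₄ ∘ₗ TensorProduct.map f g) ∘ₗ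
        lTensor C Coalgebra.comul ∘ₗ Coalgebra.comul := by
    rw [← LinearMap.comp_assoc (Coalgebra.comul (R := k)), lTensor, ← TensorProduct.map_comp]
    rfl
  have hm : m₁ ∘ₗ TensorProduct.map (m₂ ∘ₗ TensorProduct.map e f) g =
      m₃ ∘ₗ TensorProduct.map e (m₄ ∘ₗ TensorProduct.map f g) ∘ₗ
        (TensorProduct.assoc k C C C).toLinearMap := by
    ext x y z
    simp [h]
  rw [hl, hr, ← Coalgebra.coassoc]
  exact congrArg (fun F => F ∘ₗ rTensor C Coalgebra.comul ∘ₗ Coalgebra.comul) hm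

/-- The constant convolution map `c ↦ ε(c) n`. -/
noncomputable def counitMap (C : Type u) [AddCommGroup C] [Module k C] [Coalgebra k C] (n : N) :
    C →ₗ[k] N :=
  toSpanSingleton k N n ∘ₗ Coalgebra.counit

@[simp] theorem counitMap_apply (n : N) (c : C) :
    counitMap (k := k) C n c = Coalgebra.counit (R := k) c • n := rfl

theorem conv_counitMap_right {m : M ⊗[k] N →ₗ[k] P} {n : N} {p : M →ₗ[k] P}
    (h : ∀ a, m (a ⊗ₜ n) = p a) (f : C →ₗ[k] M) :
    conv m f (counitMap C n) = p ∘ₗ f := by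
  have hm : m ∘ₗ TensorProduct.map f (counitMap C n) =
      p ∘ₗ f ∘ₗ (TensorProduct.rid k C).toLinearMap ∘ₗ lTensor C (Coalgebra.counit (R := k)) := by
    ext x y
    simp [h]
  ext c
  have := LinearMap.congr_fun hm (Coalgebra.comul (R := k) c)
  simpa [conv_apply] using this

theorem conv_counitMap_left {m : M ⊗[k] N →ₗ[k] P} {n : M} {p : N →ₗ[k] P}
    (h : ∀ a, m (n ⊗ₜ a) = p a) (f : C →ₗ[k] N) :
    conv m (counitMap C n) f = p ∘ₗ f := by
  have hm : m ∘ₗ TensorProduct.map (counitMap C n) f =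
      p ∘ₗ f ∘ₗ (TensorProduct.lid k C).toLinearMap ∘ₗ rTensor C (Coalgebra.counit (R := k)) := by
    ext x y
    simp [h, ← TensorProduct.smul_tmul']
  ext c
  have := LinearMap.congr_fun hm (Coalgebra.comul (R := k) c)
  simpa [conv_apply] using this

/-- The linear map `f` is a morphism of coalgebras. -/
structure IsCoalgMap (f : C →ₗ[k] D) : Prop where
  map_comul : TensorProduct.map f f ∘ₗ Coalgebra.comul = Coalgebra.comul ∘ₗ f
  counit_comp : Coalgebra.counit ∘ₗ f = Coalgebra.counit (R := k)

theorem isCoalgMap_coalgHom (f : C →ₗc[k] D) : IsCoalgMap f.toLinearMap :=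
  ⟨f.map_comp_comul, f.counit_comp⟩

theorem IsCoalgMap.id : IsCoalgMap (LinearMap.id : C →ₗ[k] C) :=
  isCoalgMap_coalgHom (CoalgHom.id k C)

theorem IsCoalgMap.comp {g : D →ₗ[k] E} {f : C →ₗ[k] D} (hg : IsCoalgMap g)
    (hf : IsCoalgMap f) : IsCoalgMap (g ∘ₗ f) :=
  isCoalgMap_coalgHom (CoalgHom.comp ⟨g, hg.2, hg.1⟩ ⟨f, hf.2, hf.1⟩)

theorem IsCoalgMap.map {F : Type u} [AddCommGroup F] [Module k F] [Coalgebra k F]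
    {f : C →ₗ[k] D} {g : E →ₗ[k] F} (hf : IsCoalgMap f) (hg : IsCoalgMap g) :
    IsCoalgMap (TensorProduct.map f g) :=
  isCoalgMap_coalgHom (Coalgebra.TensorProduct.map (R := k) (S := k)
    (⟨f, hf.2, hf.1⟩ : C →ₗc[k] D) (⟨g, hg.2, hg.1⟩ : E →ₗc[k] F))

theorem isCoalgMap_assoc : IsCoalgMap (TensorProduct.assoc k C D E).toLinearMap :=
  isCoalgMap_coalgHom (Coalgebra.TensorProduct.assoc k k C D E).toCoalgHom

theorem isCoalgMap_assoc_symm : IsCoalgMap (TensorProduct.assoc k C D E).symm.toLinearMap :=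
  isCoalgMap_coalgHom (Coalgebra.TensorProduct.assoc k k C D E).symm.toCoalgHom

theorem conv_comp_coalgMap (m : M ⊗[k] N →ₗ[k] P) (f : D →ₗ[k] M) (g : D →ₗ[k] N)
    {h : C →ₗ[k] D} (hh : IsCoalgMap h) :
    conv m (f ∘ₗ h) (g ∘ₗ h) = conv m f g ∘ₗ h := by
  simp only [conv, TensorProduct.map_comp, LinearMap.comp_assoc, hh.map_comul]

theorem counitMap_comp_coalgMap (n : N) {h : C →ₗ[k] D} (hh : IsCoalgMap h) :
    counitMap D n ∘ₗ h = counitMap C n := by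
  simp only [counitMap, LinearMap.comp_assoc, hh.counit_comp]

theorem comp_counitMap (p : N →ₗ[k] P) (n : N) : p ∘ₗ counitMap C n = counitMap C (p n) := by
  ext c
  simp

/-- The projection `c ⊗ d ↦ ε(d) c`. -/
noncomputable def projLeft (C D : Type u) [AddCommGroup C] [Module k C]
    [AddCommGroup D] [Module k D] [Coalgebra k D] : C ⊗[k] D →ₗ[k] C :=
  (TensorProduct.rid k C).toLinearMap ∘ₗ lTensor C (Coalgebra.counit (R := k))

/-- The projection `c ⊗ d ↦ ε(c) d`. -/
noncomputable def projRight (C D : Type u) [AddCommGroup C] [Module k C] [Coalgebra k C]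
    [AddCommGroup D] [Module k D] : C ⊗[k] D →ₗ[k] D :=
  (TensorProduct.lid k D).toLinearMap ∘ₗ rTensor D (Coalgebra.counit (R := k))

@[simp] theorem projLeft_tmul (c : M) (d : D) :
    projLeft (k := k) M D (c ⊗ₜ d) = Coalgebra.counit (R := k) d • c := rfl

@[simp] theorem projRight_tmul (c : C) (d : M) :
    projRight (k := k) C M (c ⊗ₜ d) = Coalgebra.counit (R := k) c • d := rfl

theorem isCoalgMap_projLeft : IsCoalgMap (projLeft (k := k) C D) :=
  (isCoalgMap_coalgHom (Coalgebra.TensorProduct.rid k k C).toCoalgHom).comp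
    (IsCoalgMap.id.map (isCoalgMap_coalgHom (Coalgebra.counitCoalgHom k D)))

theorem isCoalgMap_projRight : IsCoalgMap (projRight (k := k) C D) :=
  (isCoalgMap_coalgHom (Coalgebra.TensorProduct.lid k D).toCoalgHom).comp
    ((isCoalgMap_coalgHom (Coalgebra.counitCoalgHom k C)).map IsCoalgMap.id)

/-- The images of `f` and `g` commute in the coalgebra sense:
`f c₍₁₎ ⊗ g c₍₂₎ = f c₍₂₎ ⊗ g c₍₁₎`. -/
def ConvCommute (f : C →ₗ[k] M) (g : C →ₗ[k] N) : Prop :=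
  conv LinearMap.id f g = conv (TensorProduct.comm k N M).toLinearMap g f

theorem conv_eq_comp_id (m : M ⊗[k] N →ₗ[k] P) (f : C →ₗ[k] M) (g : C →ₗ[k] N) :
    conv m f g = m ∘ₗ conv LinearMap.id f g := rfl

theorem conv_interchange {f : C →ₗ[k] M} {g : C →ₗ[k] N} {h : C →ₗ[k] P} {l : C →ₗ[k] Q}
    (hgh : ConvCommute g h) :
    conv (TensorProduct.tensorTensorTensorComm k M N P Q).toLinearMap
        (conv LinearMap.id f g) (conv LinearMap.id h l) =
      conv LinearMap.id (conv LinearMap.id f h) (conv LinearMap.id g l) := by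
  rw [conv_assoc (m₃ := (TensorProduct.tensorTensorTensorComm k M N P Q).toLinearMap ∘ₗ
      (TensorProduct.assoc k M N (P ⊗[k] Q)).symm.toLinearMap) (m₄ := LinearMap.id)
      (fun a b c => by simp),
    ← conv_assoc (m₁ := (TensorProduct.assoc k N P Q).toLinearMap) (m₂ := LinearMap.id)
      (fun a b c => by simp), hgh,
    conv_assoc (m₃ := (TensorProduct.assoc k M P (N ⊗[k] Q)).symm.toLinearMap)
      (m₄ := LinearMap.id) (fun a b c => by simp),
    ← conv_assoc (m₁ := (TensorProduct.assoc k P N Q).toLinearMap) (m₂ := LinearMap.id)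
      (fun a b c => by simp), conv_eq_comp_id (TensorProduct.comm k P N).toLinearMap,
    conv_comp_left]
  conv_rhs => rw [conv_eq_comp_id (TensorProduct.assoc k P N Q).toLinearMap, conv_comp_right]
  conv_lhs => rw [conv_eq_comp_id (_ ∘ₗ rTensor Q _), conv_comp_right]
  congr 1
  ext a b c d
  simp

theorem IsCoalgMap.conv_id {f : C →ₗ[k] D} {g : C →ₗ[k] E} (hf : IsCoalgMap f)
    (hg : IsCoalgMap g) (hfg : ConvCommute f g) : IsCoalgMap (conv LinearMap.id f g) where
  map_comul := by
    have h1 : Coalgebra.comul (R := k) ∘ₗ conv LinearMap.id f g =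
        conv (TensorProduct.tensorTensorTensorComm k D D E E).toLinearMap
          (conv LinearMap.id f f) (conv LinearMap.id g g) := by
      have hf' : conv LinearMap.id f f = Coalgebra.comul ∘ₗ f := hf.map_comul
      have hg' : conv LinearMap.id g g = Coalgebra.comul ∘ₗ g := hg.map_comul
      rw [hf', hg', conv_comp_comp]
      rfl
    rw [h1, conv_interchange hfg]
    rfl
  counit_comp := by
    have hf' : Coalgebra.counit (R := k) ∘ₗ f = counitMap C (1 : k) := by
      rw [hf.counit_comp]; ext; simp
    have hg' : Coalgebra.counit (R := k) ∘ₗ g = counitMap C (1 : k) := by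
      rw [hg.counit_comp]; ext; simp
    have h1 : Coalgebra.counit (R := k) ∘ₗ conv LinearMap.id f g =
        conv (TensorProduct.lid k k).toLinearMap (Coalgebra.counit (R := k) ∘ₗ f)
          (Coalgebra.counit (R := k) ∘ₗ g) := by
      rw [conv_comp_comp, comp_conv]
      congr 1
      ext a b
      simp [mul_comm]
    rw [h1, hf', hg', conv_counitMap_left (p := LinearMap.id) (fun a => by simp)]
    ext
    simp

theorem conv_projLeft_right (m : M ⊗[k] N →ₗ[k] P) (f : C ⊗[k] D →ₗ[k] M) (g : C →ₗ[k] N)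
    (c : C) (d : D) :
    conv m f (g ∘ₗ projLeft C D) (c ⊗ₜ d) =
      conv m (f ∘ₗ (TensorProduct.mk k C D).flip d) g c := by
  have h : ∀ (s : C ⊗[k] C) (t : D ⊗[k] D),
      TensorProduct.map f (g ∘ₗ projLeft C D)
        (TensorProduct.tensorTensorTensorComm k C C D D (s ⊗ₜ t)) =
      TensorProduct.map (f ∘ₗ (TensorProduct.mk k C D).flip (projLeft D D t)) g s := by
    intro s t
    induction s with
    | zero => simp
    | add s₁ s₂ h₁ h₂ => simp only [TensorProduct.add_tmul, map_add, h₁, h₂]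
    | tmul c₁ c₂ =>
      induction t with
      | zero => simp
      | add t₁ t₂ h₁ h₂ =>
        simp only [TensorProduct.tmul_add, map_add, h₁, h₂]
        simp [TensorProduct.add_tmul]
      | tmul d₁ d₂ => simp [TensorProduct.smul_tmul]
  have hd : projLeft D D (Coalgebra.comul (R := k) d) = d := by simp [projLeft]
  have := h (Coalgebra.comul c) (Coalgebra.comul d)
  rw [hd] at this
  exact congrArg m this

theorem conv_projLeft_left (m : M ⊗[k] N →ₗ[k] P) (f : C →ₗ[k] M) (g : C ⊗[k] D →ₗ[k] N)
    (c : C) (d : D) :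
    conv m (f ∘ₗ projLeft C D) g (c ⊗ₜ d) =
      conv m f (g ∘ₗ (TensorProduct.mk k C D).flip d) c := by
  have h : ∀ (s : C ⊗[k] C) (t : D ⊗[k] D),
      TensorProduct.map (f ∘ₗ projLeft C D) g
        (TensorProduct.tensorTensorTensorComm k C C D D (s ⊗ₜ t)) =
      TensorProduct.map f (g ∘ₗ (TensorProduct.mk k C D).flip (projRight D D t)) s := by
    intro s t
    induction s with
    | zero => simp
    | add s₁ s₂ h₁ h₂ => simp only [TensorProduct.add_tmul, map_add, h₁, h₂]
    | tmul c₁ c₂ =>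
      induction t with
      | zero => simp
      | add t₁ t₂ h₁ h₂ =>
        simp only [TensorProduct.tmul_add, map_add, h₁, h₂]
        simp [TensorProduct.tmul_add]
      | tmul d₁ d₂ => simp [TensorProduct.smul_tmul]
  have hd : projRight D D (Coalgebra.comul (R := k) d) = d := by simp [projRight]
  have := h (Coalgebra.comul c) (Coalgebra.comul d)
  rw [hd] at this
  exact congrArg m this

theorem conv_projRight_right (m : M ⊗[k] N →ₗ[k] P) (f : D ⊗[k] C →ₗ[k] M) (g : C →ₗ[k] N)
    (d : D) (c : C) :
    conv m f (g ∘ₗ projRight D C) (d ⊗ₜ c) = conv m (f ∘ₗ TensorProduct.mk k D C d) g c := by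
  have h : ∀ (t : D ⊗[k] D) (s : C ⊗[k] C),
      TensorProduct.map f (g ∘ₗ projRight D C)
        (TensorProduct.tensorTensorTensorComm k D D C C (t ⊗ₜ s)) =
      TensorProduct.map (f ∘ₗ TensorProduct.mk k D C (projLeft D D t)) g s := by
    intro t s
    induction s with
    | zero => simp
    | add s₁ s₂ h₁ h₂ => simp only [TensorProduct.tmul_add, map_add, h₁, h₂]
    | tmul c₁ c₂ =>
      induction t with
      | zero => simp
      | add t₁ t₂ h₁ h₂ =>
        simp only [TensorProduct.add_tmul, map_add, h₁, h₂]
        simp [TensorProduct.add_tmul]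
      | tmul d₁ d₂ => simp [← TensorProduct.smul_tmul']
  have hd : projLeft D D (Coalgebra.comul (R := k) d) = d := by simp [projLeft]
  have := h (Coalgebra.comul d) (Coalgebra.comul c)
  rw [hd] at this
  exact congrArg m this

theorem conv_projLeft_rTensor {K : Type u} [AddCommGroup K] [Module k K]
    (F : M ⊗[k] N →ₗ[k] P) (f : C →ₗ[k] M) (g : K ⊗[k] D →ₗ[k] N) (h : C →ₗ[k] K) :
    conv F (f ∘ₗ projLeft C D) (g ∘ₗ rTensor D h) =
      F ∘ₗ lTensor M g ∘ₗ (TensorProduct.assoc k M K D).toLinearMap ∘ₗ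
        rTensor D (conv LinearMap.id f h) := by
  ext c d
  have hg : (g ∘ₗ rTensor D h) ∘ₗ (TensorProduct.mk k C D).flip d =
      (g ∘ₗ (TensorProduct.mk k K D).flip d) ∘ₗ h := by
    ext; simp
  have hF : ∀ t : M ⊗[k] K, lTensor M (g ∘ₗ (TensorProduct.mk k K D).flip d) t =
      lTensor M g (TensorProduct.assoc k M K D (t ⊗ₜ d)) := by
    intro t
    induction t with
    | zero => simp
    | add t₁ t₂ h₁ h₂ => simp only [TensorProduct.add_tmul, map_add, h₁, h₂]
    | tmul a b => simp
  simp only [TensorProduct.AlgebraTensorModule.curry_apply, TensorProduct.curry_apply,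
    LinearMap.coe_restrictScalars]
  rw [conv_projLeft_left, hg, conv_comp_right, conv_eq_comp_id]
  exact congrArg F (hF _)

theorem conv_lTensor_projRight {K : Type u} [AddCommGroup K] [Module k K]
    (F : N ⊗[k] K →ₗ[k] P) (g : D ⊗[k] M →ₗ[k] N) (f : C →ₗ[k] M) (h : C →ₗ[k] K) :
    conv F (g ∘ₗ lTensor D f) (h ∘ₗ projRight D C) =
      F ∘ₗ rTensor K g ∘ₗ (TensorProduct.assoc k D M K).symm.toLinearMap ∘ₗ
        lTensor D (conv LinearMap.id f h) := by
  ext d c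
  have hg : (g ∘ₗ lTensor D f) ∘ₗ TensorProduct.mk k D C d =
      (g ∘ₗ TensorProduct.mk k D M d) ∘ₗ f := by
    ext; simp
  have hF : ∀ t : M ⊗[k] K, rTensor K (g ∘ₗ TensorProduct.mk k D M d) t =
      rTensor K g ((TensorProduct.assoc k D M K).symm (d ⊗ₜ t)) := by
    intro t
    induction t with
    | zero => simp
    | add t₁ t₂ h₁ h₂ => simp only [TensorProduct.tmul_add, map_add, h₁, h₂]
    | tmul a b => simp
  simp only [TensorProduct.AlgebraTensorModule.curry_apply, TensorProduct.curry_apply,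
    LinearMap.coe_restrictScalars]
  rw [conv_projRight_right, hg, conv_comp_left, conv_eq_comp_id]
  exact congrArg F (hF _)

end Convolution

section Hopf

variable {k}
variable {V : Type u} [AddCommGroup V] [Module k V] [Coalgebra k V]
variable {C : Type u} [AddCommGroup C] [Module k C] [Coalgebra k C]

theorem HopfStr.conv_assoc (hs : HopfStr k V) (e f g : C →ₗ[k] V) :
    conv hs.mul (conv hs.mul e f) g = conv hs.mul e (conv hs.mul f g) :=
  HopfBraceNL.conv_assoc hs.mul_assoc e f g

theorem HopfStr.isCoalgMap_mul (hs : HopfStr k V) : IsCoalgMap hs.mul where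
  map_comul := by
    ext x y
    exact (hs.comul_mul x y).symm
  counit_comp := by
    ext x y
    simp [hs.counit_mul, mul_comm]

theorem HopfStr.conv_antipode_left (hs : HopfStr k V) :
    conv hs.mul hs.antipode LinearMap.id = counitMap V hs.one :=
  hs.antipode_left

theorem HopfStr.conv_antipode_right (hs : HopfStr k V) :
    conv hs.mul LinearMap.id hs.antipode = counitMap V hs.one :=
  hs.antipode_right

theorem IsCocomm.convCommute (hV : IsCocomm k V) {M N : Type u} [AddCommGroup M] [Module k M]
    [AddCommGroup N] [Module k N] (f : V →ₗ[k] M) (g : V →ₗ[k] N) : ConvCommute f g := by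
  have h : TensorProduct.map f g =
      (TensorProduct.comm k N M).toLinearMap ∘ₗ TensorProduct.map g f ∘ₗ
        (TensorProduct.comm k V V).toLinearMap := by
    ext; simp
  unfold ConvCommute conv
  rw [h]
  simp only [LinearMap.comp_assoc]
  rw [hV, LinearMap.id_comp]

/-- The multiplication of `V ⊗ V`, factor by factor. -/
noncomputable def HopfStr.mulMap (hs : HopfStr k V) :
    (V ⊗[k] V) ⊗[k] (V ⊗[k] V) →ₗ[k] V ⊗[k] V :=
  TensorProduct.map hs.mul hs.mul ∘ₗ (TensorProduct.tensorTensorTensorComm k V V V V).toLinearMap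

theorem HopfStr.mulMap_assoc (hs : HopfStr k V) (a b c : V ⊗[k] V) :
    hs.mulMap (hs.mulMap (a ⊗ₜ b) ⊗ₜ c) = hs.mulMap (a ⊗ₜ hs.mulMap (b ⊗ₜ c)) := by
  induction a with
  | zero => simp
  | add a₁ a₂ h₁ h₂ => simp only [TensorProduct.add_tmul, map_add, h₁, h₂]
  | tmul a₁ a₂ =>
    induction b with
    | zero => simp
    | add b₁ b₂ h₁ h₂ => simp only [TensorProduct.add_tmul, TensorProduct.tmul_add, map_add, h₁, h₂]
    | tmul b₁ b₂ =>
      induction c with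
      | zero => simp
      | add c₁ c₂ h₁ h₂ => simp only [TensorProduct.tmul_add, map_add, h₁, h₂]
      | tmul c₁ c₂ => simp [mulMap, hs.mul_assoc]

theorem HopfStr.one_mulMap (hs : HopfStr k V) (a : V ⊗[k] V) :
    hs.mulMap ((hs.one ⊗ₜ hs.one) ⊗ₜ a) = a := by
  induction a with
  | zero => simp
  | add a₁ a₂ h₁ h₂ => simp only [TensorProduct.tmul_add, map_add, h₁, h₂]
  | tmul a₁ a₂ => simp [mulMap, hs.one_mul]

theorem HopfStr.mulMap_one (hs : HopfStr k V) (a : V ⊗[k] V) :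
    hs.mulMap (a ⊗ₜ (hs.one ⊗ₜ hs.one)) = a := by
  induction a with
  | zero => simp
  | add a₁ a₂ h₁ h₂ => simp only [TensorProduct.add_tmul, map_add, h₁, h₂]
  | tmul a₁ a₂ => simp [mulMap, hs.mul_one]

/-- The antipode of a cocommutative Hopf algebra is a morphism of coalgebras. -/
theorem HopfStr.isCoalgMap_antipode (hs : HopfStr k V) (hV : IsCocomm k V) :
    IsCoalgMap hs.antipode where
  map_comul := by
    have hl : conv hs.mulMap (Coalgebra.comul ∘ₗ hs.antipode) Coalgebra.comul =
        counitMap V (hs.one ⊗ₜ[k] hs.one) := by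
      have h : hs.mulMap ∘ₗ TensorProduct.map Coalgebra.comul Coalgebra.comul =
          Coalgebra.comul ∘ₗ hs.mul := hs.isCoalgMap_mul.map_comul
      have := conv_comp_comp hs.mulMap Coalgebra.comul Coalgebra.comul hs.antipode LinearMap.id
      rw [h, ← comp_conv, hs.conv_antipode_left, comp_counitMap, hs.comul_one] at this
      exact this
    have hr : conv hs.mulMap Coalgebra.comul (TensorProduct.map hs.antipode hs.antipode ∘ₗ
        Coalgebra.comul) = counitMap V (hs.one ⊗ₜ[k] hs.one) := by
      have h1 : conv LinearMap.id (LinearMap.id : V →ₗ[k] V) LinearMap.id =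
          Coalgebra.comul (R := k) := by
        simp [conv]
      have h2 : conv LinearMap.id hs.antipode hs.antipode =
          TensorProduct.map hs.antipode hs.antipode ∘ₗ Coalgebra.comul := rfl
      rw [← h2, ← h1, HopfStr.mulMap, ← comp_conv, conv_interchange (hV.convCommute _ _),
        ← conv_eq_comp_id, ← LinearMap.id_comp (TensorProduct.map hs.mul hs.mul),
        ← conv_comp_comp, comp_conv, LinearMap.comp_id,
        hs.conv_antipode_right, conv_counitMap_right (p := (TensorProduct.mk k V V).flip hs.one)
          (fun a => rfl), comp_counitMap]
      rfl
    have h := HopfBraceNL.conv_assoc hs.mulMap_assoc (Coalgebra.comul ∘ₗ hs.antipode)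
      Coalgebra.comul (TensorProduct.map hs.antipode hs.antipode ∘ₗ Coalgebra.comul)
    rw [hl, hr, conv_counitMap_left (p := LinearMap.id) hs.one_mulMap,
      conv_counitMap_right (p := LinearMap.id) hs.mulMap_one] at h
    exact h
  counit_comp := by
    have h : Coalgebra.counit (R := k) ∘ₗ conv hs.mul hs.antipode LinearMap.id =
        Coalgebra.counit ∘ₗ counitMap V hs.one := by rw [hs.conv_antipode_left]
    have h2 : Coalgebra.counit (R := k) ∘ₗ hs.mul = Coalgebra.counit (R := k) ∘ₗ projLeft V V := by
      ext x y
      simp [hs.counit_mul, mul_comm]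
    have h3 : projLeft V V ∘ₗ conv LinearMap.id hs.antipode LinearMap.id = hs.antipode := by
      have := conv_comp_right (TensorProduct.rid k V).toLinearMap Coalgebra.counit hs.antipode
        LinearMap.id
      have h4 : Coalgebra.counit (R := k) (A := V) = counitMap V (1 : k) := by ext; simp
      rw [comp_conv, LinearMap.comp_id, projLeft, ← this, LinearMap.comp_id, h4,
        conv_counitMap_right (p := LinearMap.id) (fun a => by simp), LinearMap.id_comp]
    rw [conv_eq_comp_id, ← LinearMap.comp_assoc, h2, LinearMap.comp_assoc, h3, comp_counitMap,
      hs.counit_one] at h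
    rw [h]
    ext
    simp

end Hopf

section Bilateral

variable {k}
variable {A H : Type u} [AddCommGroup A] [Module k A] [AddCommGroup H] [Module k H]

/-- `a ⊗ (b ⊗ x) ↦ ab ⊗ x`. -/
noncomputable def leftMul (H : Type u) [AddCommGroup H] [Module k H]
    (mA : A ⊗[k] A →ₗ[k] A) : A ⊗[k] (A ⊗[k] H) →ₗ[k] A ⊗[k] H :=
  rTensor H mA ∘ₗ (TensorProduct.assoc k A A H).symm.toLinearMap

/-- `(a ⊗ x) ⊗ y ↦ a ⊗ xy`. -/
noncomputable def rightMul (A : Type u) [AddCommGroup A] [Module k A]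
    (mH : H ⊗[k] H →ₗ[k] H) : (A ⊗[k] H) ⊗[k] H →ₗ[k] A ⊗[k] H :=
  lTensor A mH ∘ₗ (TensorProduct.assoc k A H H).toLinearMap

@[simp] theorem leftMul_tmul (mA : A ⊗[k] A →ₗ[k] A) (a b : A) (x : H) :
    leftMul H mA (a ⊗ₜ (b ⊗ₜ x)) = mA (a ⊗ₜ b) ⊗ₜ x := rfl

@[simp] theorem rightMul_tmul (mH : H ⊗[k] H →ₗ[k] H) (a : A) (x y : H) :
    rightMul A mH ((a ⊗ₜ x) ⊗ₜ y) = a ⊗ₜ mH (x ⊗ₜ y) := rfl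

@[simp] theorem sandwich_tmul (mA : A ⊗[k] A →ₗ[k] A) (mH : H ⊗[k] H →ₗ[k] H) (a b : A)
    (x y : H) : sandwich k mA mH ((a ⊗ₜ (b ⊗ₜ x)) ⊗ₜ y) = mA (a ⊗ₜ b) ⊗ₜ mH (x ⊗ₜ y) := rfl

theorem sandwich_eq (mA : A ⊗[k] A →ₗ[k] A) (mH : H ⊗[k] H →ₗ[k] H) (a : A)
    (t : A ⊗[k] H) (y : H) :
    sandwich k mA mH ((a ⊗ₜ t) ⊗ₜ y) = rightMul A mH (leftMul H mA (a ⊗ₜ t) ⊗ₜ y) := by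
  induction t with
  | zero => simp
  | add t₁ t₂ h₁ h₂ => simp only [TensorProduct.tmul_add, TensorProduct.add_tmul, map_add, h₁, h₂]
  | tmul b x => rfl

theorem leftMul_rightMul (mA : A ⊗[k] A →ₗ[k] A) (mH : H ⊗[k] H →ₗ[k] H) (a : A)
    (t : A ⊗[k] H) (y : H) :
    leftMul H mA (a ⊗ₜ rightMul A mH (t ⊗ₜ y)) = rightMul A mH (leftMul H mA (a ⊗ₜ t) ⊗ₜ y) := by
  induction t with
  | zero => simp
  | add t₁ t₂ h₁ h₂ => simp only [TensorProduct.tmul_add, TensorProduct.add_tmul, map_add, h₁, h₂]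
  | tmul b x => rfl

end Bilateral

section Bicrossed

variable {k}
variable {A H : Type u} [AddCommGroup A] [Module k A] [Coalgebra k A]
  [AddCommGroup H] [Module k H] [Coalgebra k H]

theorem IsCoalgebraLaw.isCoalgMap {act : H ⊗[k] A →ₗ[k] A} (h : IsCoalgebraLaw act) :
    IsCoalgMap act where
  map_comul := by
    ext x a
    exact (h.comul_act x a).symm
  counit_comp := by
    ext x a
    simp [h.counit_act, mul_comm]

theorem IsRightCoalgebraLaw.isCoalgMap {ract : H ⊗[k] A →ₗ[k] H} (h : IsRightCoalgebraLaw ract) :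
    IsCoalgMap ract where
  map_comul := by
    ext x a
    exact (h.comul_act x a).symm
  counit_comp := by
    ext x a
    simp [h.counit_act, mul_comm]

/-- The linear map `x ⊗ b ↦ (x₍₁₎ ▷ b₍₁₎) ⊗ (x₍₂₎ ◁ b₍₂₎)`. -/
noncomputable def matchedMap (tri : H ⊗[k] A →ₗ[k] A) (quad : H ⊗[k] A →ₗ[k] H) :
    H ⊗[k] A →ₗ[k] A ⊗[k] H :=
  conv LinearMap.id tri quad

theorem matchedMap_tmul (tri : H ⊗[k] A →ₗ[k] A) (quad : H ⊗[k] A →ₗ[k] H) (x : H) (b : A) :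
    matchedMap tri quad (x ⊗ₜ b) = matchedEl tri quad x b := rfl

/-- The multiplication `(a ⊗ x)(b ⊗ y) = a(x₍₁₎ ▷ b₍₁₎) ⊗ (x₍₂₎ ◁ b₍₂₎)y`. -/
noncomputable def bicrossedMul (mA : A ⊗[k] A →ₗ[k] A) (mH : H ⊗[k] H →ₗ[k] H)
    (tri : H ⊗[k] A →ₗ[k] A) (quad : H ⊗[k] A →ₗ[k] H) :
    (A ⊗[k] H) ⊗[k] (A ⊗[k] H) →ₗ[k] A ⊗[k] H :=
  sandwich k mA mH ∘ₗ rTensor H (lTensor A (matchedMap tri quad)) ∘ₗ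
    rTensor H (TensorProduct.assoc k A H A).toLinearMap ∘ₗ
    (TensorProduct.assoc k (A ⊗[k] H) A H).symm.toLinearMap

@[simp] theorem bicrossedMul_tmul (mA : A ⊗[k] A →ₗ[k] A) (mH : H ⊗[k] H →ₗ[k] H)
    (tri : H ⊗[k] A →ₗ[k] A) (quad : H ⊗[k] A →ₗ[k] H) (a b : A) (x y : H) :
    bicrossedMul mA mH tri quad ((a ⊗ₜ x) ⊗ₜ (b ⊗ₜ y)) =
      sandwich k mA mH ((a ⊗ₜ matchedMap tri quad (x ⊗ₜ b)) ⊗ₜ y) := rfl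

theorem isCoalgMap_sandwich {mA : A ⊗[k] A →ₗ[k] A} {mH : H ⊗[k] H →ₗ[k] H}
    (hmA : IsCoalgMap mA) (hmH : IsCoalgMap mH) : IsCoalgMap (sandwich k mA mH) :=
  (hmA.map hmH).comp (isCoalgMap_assoc.comp (isCoalgMap_assoc_symm.map IsCoalgMap.id))

variable {hA : HopfStr k A} {hH : HopfStr k H} {tri : H ⊗[k] A →ₗ[k] A}
  {quad : H ⊗[k] A →ₗ[k] H}

namespace IsMatchedPair

theorem isCoalgMap_matchedMap (h : IsMatchedPair hA hH tri quad) :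
    IsCoalgMap (matchedMap tri quad) := by
  refine IsCoalgMap.conv_id h.tri_coalg.isCoalgMap h.quad_coalg.isCoalgMap ?_
  refine TensorProduct.ext' fun x a => ?_
  have := congrArg (TensorProduct.comm k H A) (h.mp4 x a)
  simp only [TensorProduct.comm_comm] at this
  exact this.symm

theorem isCoalgMap_mul (h : IsMatchedPair hA hH tri quad) :
    IsCoalgMap (bicrossedMul hA.mul hH.mul tri quad) :=
  (isCoalgMap_sandwich hA.isCoalgMap_mul hH.isCoalgMap_mul).comp
    (((IsCoalgMap.id.map h.isCoalgMap_matchedMap).map IsCoalgMap.id).comp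
      ((isCoalgMap_assoc.map IsCoalgMap.id).comp isCoalgMap_assoc_symm))

theorem matchedMap_one_tmul (h : IsMatchedPair hA hH tri quad) (a : A) :
    matchedMap tri quad (hH.one ⊗ₜ a) = a ⊗ₜ hH.one := by
  have h1 : ∀ t : A ⊗[k] A, TensorProduct.map tri quad
      (TensorProduct.tensorTensorTensorComm k H H A A ((hH.one ⊗ₜ hH.one) ⊗ₜ t)) =
      projLeft A A t ⊗ₜ hH.one := by
    intro t
    induction t with
    | zero => simp
    | add t₁ t₂ h₁ h₂ => simp only [TensorProduct.tmul_add, TensorProduct.add_tmul, map_add, h₁, h₂]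
    | tmul b c => simp [h.tri_module.one_act, h.mp1', TensorProduct.smul_tmul]
  rw [matchedMap_tmul, matchedEl, split, hH.comul_one, h1]
  simp [projLeft]

theorem matchedMap_tmul_one (h : IsMatchedPair hA hH tri quad) (x : H) :
    matchedMap tri quad (x ⊗ₜ hA.one) = hA.one ⊗ₜ x := by
  have h1 : ∀ t : H ⊗[k] H, TensorProduct.map tri quad
      (TensorProduct.tensorTensorTensorComm k H H A A (t ⊗ₜ (hA.one ⊗ₜ hA.one))) =
      hA.one ⊗ₜ projRight H H t := by
    intro t
    induction t with
    | zero => simp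
    | add t₁ t₂ h₁ h₂ => simp only [TensorProduct.tmul_add, TensorProduct.add_tmul, map_add, h₁, h₂]
    | tmul b c => simp [h.quad_module.act_one, h.mp1, TensorProduct.smul_tmul]
  rw [matchedMap_tmul, matchedEl, split, hA.comul_one, h1]
  simp [projRight]

theorem matchedMap_mul_right (h : IsMatchedPair hA hH tri quad) :
    matchedMap tri quad ∘ₗ lTensor H hA.mul ∘ₗ (TensorProduct.assoc k H A A).toLinearMap =
      leftMul H hA.mul ∘ₗ lTensor A (matchedMap tri quad) ∘ₗ
        (TensorProduct.assoc k A H A).toLinearMap ∘ₗ rTensor A (matchedMap tri quad) := by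
  have hT : IsCoalgMap (lTensor H hA.mul ∘ₗ (TensorProduct.assoc k H A A).toLinearMap) :=
    (IsCoalgMap.id.map hA.isCoalgMap_mul).comp isCoalgMap_assoc
  have hU : IsCoalgMap (rTensor A quad) := h.quad_coalg.isCoalgMap.map IsCoalgMap.id
  have h1 : tri ∘ₗ lTensor H hA.mul ∘ₗ (TensorProduct.assoc k H A A).toLinearMap =
      conv hA.mul (tri ∘ₗ projLeft (H ⊗[k] A) A) (tri ∘ₗ rTensor A quad) := by
    rw [conv_projLeft_rTensor]
    ext x a b
    exact h.mp2 x a b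
  have h2 : quad ∘ₗ lTensor H hA.mul ∘ₗ (TensorProduct.assoc k H A A).toLinearMap =
      quad ∘ₗ rTensor A quad := by
    ext x a b
    exact h.quad_module.act_mul x a b
  conv_lhs => rw [matchedMap, ← conv_comp_coalgMap _ _ _ hT, h1, h2]
  rw [conv_assoc (m₃ := leftMul H hA.mul) (m₄ := LinearMap.id) (fun a b c => rfl),
    conv_comp_coalgMap _ _ _ hU]
  exact conv_projLeft_rTensor _ _ _ _

theorem matchedMap_mul_left (h : IsMatchedPair hA hH tri quad) :
    matchedMap tri quad ∘ₗ rTensor A hH.mul ∘ₗ (TensorProduct.assoc k H H A).symm.toLinearMap =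
      rightMul A hH.mul ∘ₗ rTensor H (matchedMap tri quad) ∘ₗ
        (TensorProduct.assoc k H A H).symm.toLinearMap ∘ₗ lTensor H (matchedMap tri quad) := by
  have hT : IsCoalgMap (rTensor A hH.mul ∘ₗ (TensorProduct.assoc k H H A).symm.toLinearMap) :=
    (hH.isCoalgMap_mul.map IsCoalgMap.id).comp isCoalgMap_assoc_symm
  have hU : IsCoalgMap (lTensor H tri) := IsCoalgMap.id.map h.tri_coalg.isCoalgMap
  have h1 : tri ∘ₗ rTensor A hH.mul ∘ₗ (TensorProduct.assoc k H H A).symm.toLinearMap =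
      tri ∘ₗ lTensor H tri := by
    ext x y a
    exact h.tri_module.mul_act x y a
  have h2 : quad ∘ₗ rTensor A hH.mul ∘ₗ (TensorProduct.assoc k H H A).symm.toLinearMap =
      conv hH.mul (quad ∘ₗ lTensor H tri) (quad ∘ₗ projRight H (H ⊗[k] A)) := by
    rw [conv_lTensor_projRight]
    ext x y a
    exact h.mp3 x y a
  conv_lhs => rw [matchedMap, ← conv_comp_coalgMap _ _ _ hT, h1, h2]
  rw [← conv_assoc (m₁ := rightMul A hH.mul) (m₂ := LinearMap.id) (fun a b c => rfl),
    conv_comp_coalgMap _ _ _ hU]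
  exact conv_lTensor_projRight _ _ _ _

end IsMatchedPair

theorem HopfStr.leftMul_leftMul (a b : A) (t : A ⊗[k] H) :
    leftMul H hA.mul (a ⊗ₜ leftMul H hA.mul (b ⊗ₜ t)) =
      leftMul H hA.mul (hA.mul (a ⊗ₜ b) ⊗ₜ t) := by
  induction t with
  | zero => simp
  | add t₁ t₂ h₁ h₂ => simp only [TensorProduct.tmul_add, map_add, h₁, h₂]
  | tmul c x => simp [hA.mul_assoc]

theorem HopfStr.rightMul_rightMul (t : A ⊗[k] H) (x y : H) :
    rightMul A hH.mul (rightMul A hH.mul (t ⊗ₜ x) ⊗ₜ y) =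
      rightMul A hH.mul (t ⊗ₜ hH.mul (x ⊗ₜ y)) := by
  induction t with
  | zero => simp
  | add t₁ t₂ h₁ h₂ => simp only [TensorProduct.add_tmul, map_add, h₁, h₂]
  | tmul c x => simp [hH.mul_assoc]

theorem HopfStr.one_leftMul (t : A ⊗[k] H) : leftMul H hA.mul (hA.one ⊗ₜ t) = t := by
  induction t with
  | zero => simp
  | add t₁ t₂ h₁ h₂ => simp only [TensorProduct.tmul_add, map_add, h₁, h₂]
  | tmul c x => simp [hA.one_mul]

theorem HopfStr.rightMul_one (t : A ⊗[k] H) : rightMul A hH.mul (t ⊗ₜ hH.one) = t := by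
  induction t with
  | zero => simp
  | add t₁ t₂ h₁ h₂ => simp only [TensorProduct.add_tmul, map_add, h₁, h₂]
  | tmul c x => simp [hH.mul_one]

namespace IsMatchedPair

theorem mul_assoc (h : IsMatchedPair hA hH tri quad) (p q r : A ⊗[k] H) :
    bicrossedMul hA.mul hH.mul tri quad (bicrossedMul hA.mul hH.mul tri quad (p ⊗ₜ q) ⊗ₜ r) =
      bicrossedMul hA.mul hH.mul tri quad
        (p ⊗ₜ bicrossedMul hA.mul hH.mul tri quad (q ⊗ₜ r)) := by
  let G : A ⊗[k] H → H →ₗ[k] A ⊗[k] H := fun s =>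
    rightMul A hH.mul ∘ₗ rTensor H (matchedMap tri quad) ∘ₗ
      (TensorProduct.assoc k H A H).symm.toLinearMap ∘ₗ (TensorProduct.mk k H (A ⊗[k] H)).flip s
  let G' : A ⊗[k] H → A →ₗ[k] A ⊗[k] H := fun t =>
    leftMul H hA.mul ∘ₗ lTensor A (matchedMap tri quad) ∘ₗ
      (TensorProduct.assoc k A H A).toLinearMap ∘ₗ TensorProduct.mk k (A ⊗[k] H) A t
  have hG : ∀ x y c, matchedMap tri quad (hH.mul (x ⊗ₜ y) ⊗ₜ c) =
      G (matchedMap tri quad (y ⊗ₜ c)) x := fun x y c =>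
    LinearMap.congr_fun h.matchedMap_mul_left (x ⊗ₜ (y ⊗ₜ c))
  have hG' : ∀ x b c, matchedMap tri quad (x ⊗ₜ hA.mul (b ⊗ₜ c)) =
      G' (matchedMap tri quad (x ⊗ₜ b)) c := fun x b c =>
    LinearMap.congr_fun h.matchedMap_mul_right ((x ⊗ₜ b) ⊗ₜ c)
  have hl : ∀ a t y c z, bicrossedMul hA.mul hH.mul tri quad
      (sandwich k hA.mul hH.mul ((a ⊗ₜ t) ⊗ₜ y) ⊗ₜ (c ⊗ₜ z)) =
      sandwich k hA.mul hH.mul ((a ⊗ₜ leftMul H hA.mul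
        (lTensor A (G (matchedMap tri quad (y ⊗ₜ c))) t)) ⊗ₜ z) := by
    intro a t y c z
    induction t with
    | zero => simp
    | add t₁ t₂ h₁ h₂ =>
      simp only [TensorProduct.tmul_add, TensorProduct.add_tmul, map_add, h₁, h₂]
    | tmul b x =>
      rw [sandwich_tmul, bicrossedMul_tmul, hG, sandwich_eq, sandwich_eq, lTensor_tmul,
        HopfStr.leftMul_leftMul]
  have hr : ∀ a x b s z, bicrossedMul hA.mul hH.mul tri quad
      ((a ⊗ₜ x) ⊗ₜ sandwich k hA.mul hH.mul ((b ⊗ₜ s) ⊗ₜ z)) =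
      sandwich k hA.mul hH.mul ((a ⊗ₜ rightMul A hH.mul
        (rTensor H (G' (matchedMap tri quad (x ⊗ₜ b))) s)) ⊗ₜ z) := by
    intro a x b s z
    induction s with
    | zero => simp
    | add t₁ t₂ h₁ h₂ =>
      simp only [TensorProduct.tmul_add, TensorProduct.add_tmul, map_add, h₁, h₂]
    | tmul c y =>
      rw [sandwich_tmul, bicrossedMul_tmul, hG', sandwich_eq, sandwich_eq, rTensor_tmul,
        leftMul_rightMul, HopfStr.rightMul_rightMul]
  have hGG : ∀ t s, leftMul H hA.mul (lTensor A (G s) t) =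
      rightMul A hH.mul (rTensor H (G' t) s) := by
    have hGa : ∀ s₁ s₂, G (s₁ + s₂) = G s₁ + G s₂ := fun s₁ s₂ => by
      simp only [G, map_add, LinearMap.comp_add]
    have hGa' : ∀ s₁ s₂, G' (s₁ + s₂) = G' s₁ + G' s₂ := fun s₁ s₂ => by
      simp only [G', map_add, LinearMap.comp_add]
    have hG0 : G 0 = 0 := by simp only [G, map_zero, LinearMap.comp_zero]
    have hG0' : G' 0 = 0 := by simp only [G', map_zero, LinearMap.comp_zero]
    intro t s
    induction t with
    | zero => simp [hG0']
    | add t₁ t₂ h₁ h₂ =>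
      simp only [map_add, hGa', LinearMap.rTensor_add, LinearMap.add_apply, h₁, h₂]
    | tmul b x =>
      induction s with
      | zero => simp [hG0]
      | add t₁ t₂ h₁ h₂ =>
        simp only [map_add, hGa, LinearMap.lTensor_add, LinearMap.add_apply, h₁, h₂]
      | tmul c y => exact leftMul_rightMul _ _ _ _ _
  induction p with
  | zero => simp
  | add t₁ t₂ h₁ h₂ => simp only [TensorProduct.add_tmul, map_add, h₁, h₂]
  | tmul a x =>
    induction q with
    | zero => simp
    | add t₁ t₂ h₁ h₂ =>
      simp only [TensorProduct.add_tmul, TensorProduct.tmul_add, map_add, h₁, h₂]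
    | tmul b y =>
      induction r with
      | zero => simp
      | add t₁ t₂ h₁ h₂ => simp only [TensorProduct.tmul_add, map_add, h₁, h₂]
      | tmul c z => rw [bicrossedMul_tmul, bicrossedMul_tmul, hl, hr, hGG]

theorem mul_inclLeft_left (h : IsMatchedPair hA hH tri quad) (a : A) (v : A ⊗[k] H) :
    bicrossedMul hA.mul hH.mul tri quad ((a ⊗ₜ hH.one) ⊗ₜ v) = leftMul H hA.mul (a ⊗ₜ v) := by
  induction v with
  | zero => simp
  | add t₁ t₂ h₁ h₂ => simp only [TensorProduct.tmul_add, map_add, h₁, h₂]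
  | tmul c z => simp [h.matchedMap_one_tmul, hH.one_mul]

theorem mul_inclRight_right (h : IsMatchedPair hA hH tri quad) (v : A ⊗[k] H) (y : H) :
    bicrossedMul hA.mul hH.mul tri quad (v ⊗ₜ (hA.one ⊗ₜ y)) = rightMul A hH.mul (v ⊗ₜ y) := by
  induction v with
  | zero => simp
  | add t₁ t₂ h₁ h₂ => simp only [TensorProduct.add_tmul, map_add, h₁, h₂]
  | tmul c z => simp [h.matchedMap_tmul_one, hA.mul_one]

theorem mul_inclRight_inclLeft (tri : H ⊗[k] A →ₗ[k] A) (quad : H ⊗[k] A →ₗ[k] H)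
    (x : H) (a : A) :
    bicrossedMul hA.mul hH.mul tri quad ((hA.one ⊗ₜ x) ⊗ₜ (a ⊗ₜ hH.one)) =
      matchedMap tri quad (x ⊗ₜ a) := by
  rw [bicrossedMul_tmul, sandwich_eq, HopfStr.one_leftMul, HopfStr.rightMul_one]

end IsMatchedPair

/-- The inclusion `a ↦ a ⊗ 1`. -/
noncomputable def inclLeft (A : Type u) [AddCommGroup A] [Module k A] (hH : HopfStr k H) :
    A →ₗ[k] A ⊗[k] H :=
  (TensorProduct.mk k A H).flip hH.one

/-- The inclusion `x ↦ 1 ⊗ x`. -/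
noncomputable def inclRight (H : Type u) [AddCommGroup H] [Module k H] (hA : HopfStr k A) :
    H →ₗ[k] A ⊗[k] H :=
  TensorProduct.mk k A H hA.one

@[simp] theorem inclLeft_apply (a : A) : inclLeft A hH a = a ⊗ₜ hH.one := rfl

@[simp] theorem inclRight_apply (x : H) : inclRight H hA x = hA.one ⊗ₜ x := rfl

theorem conv_projLeft_projRight {M N P : Type u} [AddCommGroup M] [Module k M]
    [AddCommGroup N] [Module k N] [AddCommGroup P] [Module k P]
    (m : M ⊗[k] N →ₗ[k] P) (f : A →ₗ[k] M) (g : H →ₗ[k] N) :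
    conv m (f ∘ₗ projLeft A H) (g ∘ₗ projRight A H) = m ∘ₗ TensorProduct.map f g := by
  ext a x
  have h : (g ∘ₗ projRight A H) ∘ₗ (TensorProduct.mk k A H).flip x = counitMap A (g x) := by
    ext; simp
  simp only [TensorProduct.AlgebraTensorModule.curry_apply, TensorProduct.curry_apply,
    LinearMap.coe_restrictScalars]
  rw [conv_projLeft_left, h,
    conv_counitMap_right (p := m ∘ₗ (TensorProduct.mk k M N).flip (g x)) (fun a => rfl)]
  rfl

namespace IsMatchedPair

/-- `id = (a ⊗ x ↦ (a ⊗ 1)(1 ⊗ x))`, as a convolution. -/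
theorem conv_inclLeft_inclRight (h : IsMatchedPair hA hH tri quad) :
    conv (bicrossedMul hA.mul hH.mul tri quad) (inclLeft A hH ∘ₗ projLeft A H)
      (inclRight H hA ∘ₗ projRight A H) = LinearMap.id := by
  rw [conv_projLeft_projRight]
  ext a x
  simp [h.matchedMap_one_tmul, hA.mul_one, hH.one_mul]

/-- The antipode `a ⊗ x ↦ (1 ⊗ S x)(S a ⊗ 1)` of a bicrossed product. -/
noncomputable def antipode (_ : IsMatchedPair hA hH tri quad) : A ⊗[k] H →ₗ[k] A ⊗[k] H :=
  conv (bicrossedMul hA.mul hH.mul tri quad) (inclRight H hA ∘ₗ hH.antipode ∘ₗ projRight A H)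
    (inclLeft A hH ∘ₗ hA.antipode ∘ₗ projLeft A H)

theorem conv_inclLeft (h : IsMatchedPair hA hH tri quad) {C : Type u} [AddCommGroup C]
    [Module k C] [Coalgebra k C] (f g : C →ₗ[k] A) :
    conv (bicrossedMul hA.mul hH.mul tri quad) (inclLeft A hH ∘ₗ f) (inclLeft A hH ∘ₗ g) =
      inclLeft A hH ∘ₗ conv hA.mul f g := by
  rw [conv_comp_comp, comp_conv]
  congr 1
  ext a b
  simp [h.matchedMap_one_tmul, hH.one_mul]

theorem conv_inclRight (h : IsMatchedPair hA hH tri quad) {C : Type u} [AddCommGroup C]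
    [Module k C] [Coalgebra k C] (f g : C →ₗ[k] H) :
    conv (bicrossedMul hA.mul hH.mul tri quad) (inclRight H hA ∘ₗ f) (inclRight H hA ∘ₗ g) =
      inclRight H hA ∘ₗ conv hH.mul f g := by
  rw [conv_comp_comp, comp_conv]
  congr 1
  ext a b
  simp [h.matchedMap_tmul_one, hA.one_mul]

theorem one_mul (h : IsMatchedPair hA hH tri quad) (v : A ⊗[k] H) :
    bicrossedMul hA.mul hH.mul tri quad ((hA.one ⊗ₜ hH.one) ⊗ₜ v) = v := by
  rw [h.mul_inclLeft_left, HopfStr.one_leftMul]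

theorem mul_one (h : IsMatchedPair hA hH tri quad) (v : A ⊗[k] H) :
    bicrossedMul hA.mul hH.mul tri quad (v ⊗ₜ (hA.one ⊗ₜ hH.one)) = v := by
  rw [h.mul_inclRight_right, HopfStr.rightMul_one]

theorem conv_antipode_left (h : IsMatchedPair hA hH tri quad) :
    conv (bicrossedMul hA.mul hH.mul tri quad) h.antipode LinearMap.id =
      counitMap (A ⊗[k] H) (hA.one ⊗ₜ[k] hH.one) := by
  have h1 : conv hA.mul (hA.antipode ∘ₗ projLeft A H) (projLeft A H) =
      counitMap (A ⊗[k] H) hA.one := by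
    rw [← counitMap_comp_coalgMap _ isCoalgMap_projLeft, ← hA.conv_antipode_left]
    exact conv_comp_coalgMap _ _ LinearMap.id isCoalgMap_projLeft
  have h2 : conv hH.mul (hH.antipode ∘ₗ projRight A H) (projRight A H) =
      counitMap (A ⊗[k] H) hH.one := by
    rw [← counitMap_comp_coalgMap _ isCoalgMap_projRight, ← hH.conv_antipode_left]
    exact conv_comp_coalgMap _ _ LinearMap.id isCoalgMap_projRight
  rw [← h.conv_inclLeft_inclRight, antipode, conv_assoc h.mul_assoc, ← conv_assoc h.mul_assoc
    (inclLeft A hH ∘ₗ _), h.conv_inclLeft, h1, comp_counitMap, inclLeft_apply,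
    conv_counitMap_left (p := LinearMap.id) h.one_mul, LinearMap.id_comp, h.conv_inclRight, h2,
    comp_counitMap]
  rfl

theorem conv_antipode_right (h : IsMatchedPair hA hH tri quad) :
    conv (bicrossedMul hA.mul hH.mul tri quad) LinearMap.id h.antipode =
      counitMap (A ⊗[k] H) (hA.one ⊗ₜ[k] hH.one) := by
  have h1 : conv hA.mul (projLeft A H) (hA.antipode ∘ₗ projLeft A H) =
      counitMap (A ⊗[k] H) hA.one := by
    rw [← counitMap_comp_coalgMap _ isCoalgMap_projLeft, ← hA.conv_antipode_right]
    exact conv_comp_coalgMap _ LinearMap.id _ isCoalgMap_projLeft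
  have h2 : conv hH.mul (projRight A H) (hH.antipode ∘ₗ projRight A H) =
      counitMap (A ⊗[k] H) hH.one := by
    rw [← counitMap_comp_coalgMap _ isCoalgMap_projRight, ← hH.conv_antipode_right]
    exact conv_comp_coalgMap _ LinearMap.id _ isCoalgMap_projRight
  rw [← h.conv_inclLeft_inclRight, antipode, conv_assoc h.mul_assoc, ← conv_assoc h.mul_assoc
    (inclRight H hA ∘ₗ _), h.conv_inclRight, h2, comp_counitMap, inclRight_apply,
    conv_counitMap_left (p := LinearMap.id) h.one_mul, LinearMap.id_comp, h.conv_inclLeft, h1,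
    comp_counitMap]
  rfl

/-- The bicrossed product Hopf algebra of a matched pair. -/
noncomputable def bicrossed (h : IsMatchedPair hA hH tri quad) : HopfStr k (A ⊗[k] H) where
  mul := bicrossedMul hA.mul hH.mul tri quad
  one := hA.one ⊗ₜ hH.one
  mul_assoc := h.mul_assoc
  one_mul := h.one_mul
  mul_one := h.mul_one
  comul_mul a b := (LinearMap.congr_fun h.isCoalgMap_mul.map_comul (a ⊗ₜ b)).symm
  counit_mul a b := by
    have := LinearMap.congr_fun h.isCoalgMap_mul.counit_comp (a ⊗ₜ b)
    simpa [mul_comm] using this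
  comul_one := by
    rw [TensorProduct.comul_tmul, hA.comul_one, hH.comul_one]
    rfl
  counit_one := by simp [hA.counit_one, hH.counit_one]
  antipode := h.antipode
  antipode_left := h.conv_antipode_left
  antipode_right := h.conv_antipode_right

end IsMatchedPair

end Bicrossed

section Smash

variable {k}
variable {A H : Type u} [AddCommGroup A] [Module k A] [Coalgebra k A]
  [AddCommGroup H] [Module k H] [Coalgebra k H]

theorem matchedMap_projLeft (act : H ⊗[k] A →ₗ[k] A) (x : H) (b : A) :
    matchedMap act (projLeft H A) (x ⊗ₜ b) =
      conv LinearMap.id (act ∘ₗ (TensorProduct.mk k H A).flip b) LinearMap.id x :=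
  conv_projLeft_right LinearMap.id act LinearMap.id x b

theorem matchedMap_projLeft_eq_smashEl (act : H ⊗[k] A →ₗ[k] A) (x : H) (b : A) :
    matchedMap act (projLeft H A) (x ⊗ₜ b) = smashEl act x b := by
  rw [matchedMap_projLeft, conv_apply, smashEl, LinearMap.id_apply]
  generalize Coalgebra.comul (R := k) x = t
  induction t with
  | zero => simp
  | add t₁ t₂ h₁ h₂ => simp only [TensorProduct.add_tmul, map_add, h₁, h₂]
  | tmul y z => simp [rightComm]

/-- A module bialgebra over a cocommutative Hopf algebra is a matched pair with trivial right
action. -/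
theorem IsLeftModuleBialgebra.isMatchedPair {hA : HopfStr k A} {hH : HopfStr k H}
    {act : H ⊗[k] A →ₗ[k] A} (h : IsLeftModuleBialgebra hH hA act) (hV : IsCocomm k H) :
    IsMatchedPair hA hH act (projLeft H A) where
  tri_module := h.toIsLeftModule
  tri_coalg := h.toCoalgLaw
  quad_module :=
    { act_one := fun x => by simp [hA.counit_one]
      act_mul := fun x a b => by simp [hA.counit_mul, smul_smul, mul_comm] }
  quad_coalg :=
    { comul_act := fun x a =>
        (LinearMap.congr_fun isCoalgMap_projLeft.map_comul (x ⊗ₜ[k] a)).symm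
      counit_act := fun x a => by simp [mul_comm] }
  mp1 := h.toLaw.act_one
  mp1' a := rfl
  mp2 x a b := by
    rw [h.toLaw.act_mul]
    change _ = hA.mul (lTensor A act (TensorProduct.assoc k A H A
      (matchedMap act (projLeft H A) (x ⊗ₜ a) ⊗ₜ[k] b)))
    rw [matchedMap_projLeft, conv_apply, LinearMap.id_apply]
    generalize Coalgebra.comul (R := k) x = t
    congr 1
    induction t with
    | zero => simp
    | add t₁ t₂ h₁ h₂ => simp only [TensorProduct.add_tmul, map_add, h₁, h₂]
    | tmul y z => simp
  mp3 x y a := by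
    change _ = hH.mul (rTensor H (projLeft H A) ((TensorProduct.assoc k H A H).symm
      (x ⊗ₜ[k] matchedMap act (projLeft H A) (y ⊗ₜ a))))
    have ht : ∀ t : H ⊗[k] H, hH.mul (rTensor H (projLeft H A)
        ((TensorProduct.assoc k H A H).symm (x ⊗ₜ[k]
          TensorProduct.map (act ∘ₗ (TensorProduct.mk k H A).flip a) LinearMap.id t))) =
        Coalgebra.counit (R := k) a • hH.mul (x ⊗ₜ projRight H H t) := by
      intro t
      induction t with
      | zero => simp
      | add t₁ t₂ h₁ h₂ => simp only [TensorProduct.tmul_add, map_add, smul_add, h₁, h₂]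
      | tmul y z =>
        simp [h.toCoalgLaw.counit_act, ← TensorProduct.smul_tmul', smul_smul, mul_comm]
    rw [matchedMap_projLeft, conv_apply, LinearMap.id_apply, ht]
    simp [projRight]
  mp4 x a := by
    change conv LinearMap.id (LinearMap.id ∘ₗ projLeft H A) act (x ⊗ₜ a) =
      TensorProduct.comm k A H (matchedMap act (projLeft H A) (x ⊗ₜ a))
    rw [matchedMap_projLeft, conv_projLeft_left]
    exact LinearMap.congr_fun (hV.convCommute LinearMap.id _) x

theorem projLeft_comp_conv {C : Type u} [AddCommGroup C] [Module k C] [Coalgebra k C]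
    {f : C →ₗ[k] A} {g : C →ₗ[k] H} (hg : IsCoalgMap g) :
    projLeft A H ∘ₗ conv LinearMap.id f g = f := by
  have h : Coalgebra.counit (R := k) ∘ₗ g = counitMap C (1 : k) := by
    rw [hg.counit_comp]; ext; simp
  have := conv_comp_right (TensorProduct.rid k A).toLinearMap (Coalgebra.counit (R := k)) f g
  rw [comp_conv, LinearMap.comp_id, projLeft, ← this, h,
    conv_counitMap_right (p := LinearMap.id) (fun a => by simp), LinearMap.id_comp]

theorem projRight_comp_conv {C : Type u} [AddCommGroup C] [Module k C] [Coalgebra k C]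
    {f : C →ₗ[k] A} {g : C →ₗ[k] H} (hf : IsCoalgMap f) :
    projRight A H ∘ₗ conv LinearMap.id f g = g := by
  have h : Coalgebra.counit (R := k) ∘ₗ f = counitMap C (1 : k) := by
    rw [hf.counit_comp]; ext; simp
  have := conv_comp_left (TensorProduct.lid k H).toLinearMap (Coalgebra.counit (R := k)) f g
  rw [comp_conv, LinearMap.comp_id, projRight, ← this, h,
    conv_counitMap_left (p := LinearMap.id) (fun a => by simp), LinearMap.id_comp]

end Smash

section Brace

variable {k}

theorem braceRHS_tmul {V : Type u} [AddCommGroup V] [Module k V] [Coalgebra k V]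
    (m : V ⊗[k] V →ₗ[k] V) (S : V →ₗ[k] V) (m' : V ⊗[k] V →ₗ[k] V) (p w w' : V) :
    braceRHS m S m' (p ⊗ₜ (w ⊗ₜ w')) =
      conv m (m' ∘ₗ (TensorProduct.mk k V V).flip w)
        (conv m S (m' ∘ₗ (TensorProduct.mk k V V).flip w')) p := by
  have h1 : ∀ (r : V) (t : V ⊗[k] V), m (lTensor V m (TensorProduct.map m'
      (TensorProduct.map S m') (lTensor (V ⊗[k] V) (TensorProduct.assoc k V V V).toLinearMap
        (TensorProduct.tensorTensorTensorComm k V (V ⊗[k] V) V V ((r ⊗ₜ t) ⊗ₜ (w ⊗ₜ w')))))) =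
      m (m' (r ⊗ₜ w) ⊗ₜ m (TensorProduct.map S
        (m' ∘ₗ (TensorProduct.mk k V V).flip w') t)) := by
    intro r t
    induction t with
    | zero => simp
    | add t₁ t₂ h₁ h₂ => simp only [TensorProduct.tmul_add, TensorProduct.add_tmul, map_add, h₁, h₂]
    | tmul y z => simp
  have h2 : ∀ t : V ⊗[k] V, m (lTensor V m (TensorProduct.map m'
      (TensorProduct.map S m') (lTensor (V ⊗[k] V) (TensorProduct.assoc k V V V).toLinearMap
        (TensorProduct.tensorTensorTensorComm k V (V ⊗[k] V) V V
          (lTensor V Coalgebra.comul t ⊗ₜ (w ⊗ₜ w')))))) =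
      m (TensorProduct.map (m' ∘ₗ (TensorProduct.mk k V V).flip w)
        (conv m S (m' ∘ₗ (TensorProduct.mk k V V).flip w')) t) := by
    intro t
    induction t with
    | zero => simp
    | add t₁ t₂ h₁ h₂ => simp only [TensorProduct.add_tmul, map_add, h₁, h₂]
    | tmul y z => exact h1 y _
  exact h2 _

variable {A H : Type u} [AddCommGroup A] [Module k A] [Coalgebra k A]
  [AddCommGroup H] [Module k H] [Coalgebra k H]

theorem HopfBrace.circ_mul (BH : HopfBrace k H) (y z : H) :
    BH.circ.mul ∘ₗ (TensorProduct.mk k H H).flip (BH.dot.mul (y ⊗ₜ z)) =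
      conv BH.dot.mul (BH.circ.mul ∘ₗ (TensorProduct.mk k H H).flip y)
        (conv BH.dot.mul BH.dot.antipode (BH.circ.mul ∘ₗ (TensorProduct.mk k H H).flip z)) := by
  ext x
  rw [← braceRHS_tmul, ← BH.brace]
  rfl

theorem conv_projLeft_rTensor_projLeft_tmul {M N P : Type u} [AddCommGroup M] [Module k M]
    [AddCommGroup N] [Module k N] [AddCommGroup P] [Module k P] (m : M ⊗[k] N →ₗ[k] P)
    (f : H ⊗[k] H →ₗ[k] M) (g : H ⊗[k] A →ₗ[k] N) (x y : H) (c : A) :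
    conv m (f ∘ₗ projLeft (H ⊗[k] H) A) (g ∘ₗ rTensor A (projLeft H H)) ((x ⊗ₜ y) ⊗ₜ c) =
      conv m (f ∘ₗ (TensorProduct.mk k H H).flip y) (g ∘ₗ (TensorProduct.mk k H A).flip c) x := by
  have h : (g ∘ₗ rTensor A (projLeft H H)) ∘ₗ (TensorProduct.mk k (H ⊗[k] H) A).flip c =
      (g ∘ₗ (TensorProduct.mk k H A).flip c) ∘ₗ projLeft H H := rfl
  rw [conv_projLeft_left, h, conv_projLeft_right]

theorem conv_rTensor_projLeft_projLeft_tmul {M N P : Type u} [AddCommGroup M] [Module k M]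
    [AddCommGroup N] [Module k N] [AddCommGroup P] [Module k P] (m : N ⊗[k] M →ₗ[k] P)
    (f : H ⊗[k] H →ₗ[k] M) (g : H ⊗[k] A →ₗ[k] N) (x y : H) (c : A) :
    conv m (g ∘ₗ rTensor A (projLeft H H)) (f ∘ₗ projLeft (H ⊗[k] H) A) ((x ⊗ₜ y) ⊗ₜ c) =
      conv m (g ∘ₗ (TensorProduct.mk k H A).flip c) (f ∘ₗ (TensorProduct.mk k H H).flip y) x := by
  have h : (g ∘ₗ rTensor A (projLeft H H)) ∘ₗ (TensorProduct.mk k (H ⊗[k] H) A).flip c =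
      (g ∘ₗ (TensorProduct.mk k H A).flip c) ∘ₗ projLeft H H := rfl
  rw [conv_projLeft_right, h, conv_projLeft_left]

/-- The linear map `(x ⊗ y) ↦ (x₍₁₎ ∘ y)·S(x₍₂₎)`. -/
noncomputable def HopfBrace.twist (BH : HopfBrace k H) : H ⊗[k] H →ₗ[k] H :=
  conv BH.dot.mul BH.circ.mul (BH.dot.antipode ∘ₗ projLeft H H)

theorem HopfBrace.twist_comp_flip (BH : HopfBrace k H) (y : H) :
    BH.twist ∘ₗ (TensorProduct.mk k H H).flip y =
      conv BH.dot.mul (BH.circ.mul ∘ₗ (TensorProduct.mk k H H).flip y) BH.dot.antipode := by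
  ext x
  exact conv_projLeft_right _ _ _ _ _

theorem HopfBrace.isCoalgMap_twist (BH : HopfBrace k H) (hV : IsCocomm k H) :
    IsCoalgMap BH.twist := by
  refine BH.dot.isCoalgMap_mul.comp (IsCoalgMap.conv_id BH.circ.isCoalgMap_mul
    ((BH.dot.isCoalgMap_antipode hV).comp isCoalgMap_projLeft) ?_)
  refine TensorProduct.ext' fun x y => ?_
  rw [conv_projLeft_right, conv_projLeft_left]
  exact LinearMap.congr_fun (hV.convCommute _ _) x

/-- The linear map `(x ⊗ y) ⊗ c ↦ (x₍₁₎ ∘ y)·S(x₍₂₎) ⊗ (x₍₃₎ ▶ c)`. -/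
noncomputable def HopfBrace.twistMap (BH : HopfBrace k H) (act : H ⊗[k] A →ₗ[k] A) :
    (H ⊗[k] H) ⊗[k] A →ₗ[k] H ⊗[k] A :=
  conv LinearMap.id (BH.twist ∘ₗ projLeft (H ⊗[k] H) A) (act ∘ₗ rTensor A (projLeft H H))

theorem HopfBrace.twistMap_tmul (BH : HopfBrace k H) (act : H ⊗[k] A →ₗ[k] A) (x y : H) (c : A) :
    BH.twistMap act ((x ⊗ₜ y) ⊗ₜ c) =
      conv LinearMap.id
        (conv BH.dot.mul (BH.circ.mul ∘ₗ (TensorProduct.mk k H H).flip y) BH.dot.antipode)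
        (act ∘ₗ (TensorProduct.mk k H A).flip c) x := by
  rw [twistMap, conv_projLeft_rTensor_projLeft_tmul, twist_comp_flip]

theorem HopfBrace.isCoalgMap_twistMap (BH : HopfBrace k H) (hV : IsCocomm k H)
    {act : H ⊗[k] A →ₗ[k] A} (hact : IsCoalgMap act) : IsCoalgMap (BH.twistMap act) := by
  refine IsCoalgMap.conv_id ((BH.isCoalgMap_twist hV).comp isCoalgMap_projLeft)
    (hact.comp (isCoalgMap_projLeft.map IsCoalgMap.id)) ?_
  refine TensorProduct.ext_threefold fun x y c => ?_
  rw [conv_projLeft_rTensor_projLeft_tmul, conv_rTensor_projLeft_projLeft_tmul]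
  exact LinearMap.congr_fun (hV.convCommute _ _) x

variable {hA : HopfStr k A} {BH : HopfBrace k H} {tri : H ⊗[k] A →ₗ[k] A}
  {quad : H ⊗[k] A →ₗ[k] H} {act : H ⊗[k] A →ₗ[k] A}

theorem act_comp_lTensor
    (h21 : ∀ (x x' : H) (a : A),
      act (x ⊗ₜ[k] tri (x' ⊗ₜ[k] a)) =
        tri (TensorProduct.map
          (BH.dot.mul ∘ₗ TensorProduct.map
            (BH.circ.mul ∘ₗ (TensorProduct.mk k H H).flip x') BH.dot.antipode)
          (act ∘ₗ (TensorProduct.mk k H A).flip a)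
          (rTensor H (Coalgebra.comul (R := k)) (Coalgebra.comul (R := k) x)))) :
    (act ∘ₗ lTensor H tri) ∘ₗ (TensorProduct.assoc k H H A).toLinearMap =
      tri ∘ₗ BH.twistMap act := by
  refine TensorProduct.ext_threefold fun x y c => ?_
  rw [LinearMap.comp_apply tri, BH.twistMap_tmul]
  refine (h21 x y c).trans (congrArg tri ?_)
  rw [← LinearMap.comp_apply (TensorProduct.map _ _), rTensor, ← TensorProduct.map_comp,
    LinearMap.comp_assoc, LinearMap.comp_id]
  rfl

theorem circ_mul_comp_lTensor
    (h22 : ∀ (x x' : H) (a : A),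
      BH.circ.mul (x ⊗ₜ[k] quad (x' ⊗ₜ[k] a)) =
        BH.dot.mul (rTensor H quad ((TensorProduct.assoc k H A H).symm
          (TensorProduct.map
            (BH.dot.mul ∘ₗ TensorProduct.map
              (BH.circ.mul ∘ₗ (TensorProduct.mk k H H).flip x') BH.dot.antipode)
            (rTensor H (act ∘ₗ (TensorProduct.mk k H A).flip a))
            (lTensor (H ⊗[k] H) (Coalgebra.comul (R := k))
              (rTensor H (Coalgebra.comul (R := k)) (Coalgebra.comul (R := k) x))))))) :
    (BH.circ.mul ∘ₗ lTensor H quad) ∘ₗ (TensorProduct.assoc k H H A).toLinearMap =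
      conv BH.dot.mul (quad ∘ₗ BH.twistMap act) (projLeft H H ∘ₗ projLeft (H ⊗[k] H) A) := by
  refine TensorProduct.ext_threefold fun x y c => ?_
  have ht : ((quad ∘ₗ BH.twistMap act) ∘ₗ (TensorProduct.mk k (H ⊗[k] H) A).flip c) ∘ₗ
      (TensorProduct.mk k H H).flip y = quad ∘ₗ conv LinearMap.id
        (conv BH.dot.mul (BH.circ.mul ∘ₗ (TensorProduct.mk k H H).flip y) BH.dot.antipode)
        (act ∘ₗ (TensorProduct.mk k H A).flip c) := by
    ext z
    exact congrArg quad (BH.twistMap_tmul act z y c)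
  rw [conv_projLeft_right, ← LinearMap.id_comp (projLeft H H), conv_projLeft_right, ht, comp_conv,
    conv_assoc (m₃ := BH.dot.mul ∘ₗ rTensor H quad ∘ₗ
      (TensorProduct.assoc k H A H).symm.toLinearMap) (m₄ := LinearMap.id) (fun a b c => by simp)]
  refine (h22 x y c).trans ?_
  rw [← LinearMap.comp_apply (lTensor _ _), ← LinearMap.comp_apply (TensorProduct.map _ _),
    lTensor_comp_rTensor, ← TensorProduct.map_comp, LinearMap.comp_assoc]
  rfl

/-- The restriction `x ↦ (1 ⊗ x) ∘ w` to `H` of right multiplication by `w` in the smash product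
`A # H`. -/
noncomputable def smashRight (act : H ⊗[k] A →ₗ[k] A) (mH : H ⊗[k] H →ₗ[k] H)
    (w : A ⊗[k] H) : H →ₗ[k] A ⊗[k] H :=
  rightMul A mH ∘ₗ rTensor H (matchedMap act (projLeft H A)) ∘ₗ
    (TensorProduct.assoc k H A H).symm.toLinearMap ∘ₗ (TensorProduct.mk k H (A ⊗[k] H)).flip w

theorem smashRight_zero (act : H ⊗[k] A →ₗ[k] A) (mH : H ⊗[k] H →ₗ[k] H) :
    smashRight act mH 0 = 0 := by
  simp only [smashRight, map_zero, LinearMap.comp_zero]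

theorem smashRight_add (act : H ⊗[k] A →ₗ[k] A) (mH : H ⊗[k] H →ₗ[k] H) (v w : A ⊗[k] H) :
    smashRight act mH (v + w) = smashRight act mH v + smashRight act mH w := by
  simp only [smashRight, map_add, LinearMap.comp_add]

theorem smashRight_tmul (act : H ⊗[k] A →ₗ[k] A) (mH : H ⊗[k] H →ₗ[k] H) (c : A) (z : H) :
    smashRight act mH (c ⊗ₜ z) = conv LinearMap.id (act ∘ₗ (TensorProduct.mk k H A).flip c)
      (mH ∘ₗ (TensorProduct.mk k H H).flip z) := by
  ext x
  rw [← LinearMap.comp_id (TensorProduct.mk k H H |>.flip z), ← LinearMap.comp_assoc,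
    conv_comp_right, LinearMap.id_comp, conv_eq_comp_id, LinearMap.comp_apply,
    ← matchedMap_projLeft]
  change rightMul A mH (matchedMap act (projLeft H A) (x ⊗ₜ c) ⊗ₜ z) = _
  generalize matchedMap act (projLeft H A) (x ⊗ₜ c) = t
  induction t with
  | zero => simp
  | add t₁ t₂ h₁ h₂ => simp only [TensorProduct.add_tmul, map_add, h₁, h₂]
  | tmul b y => simp

theorem smashRight_leftMul (hmb : IsLeftModuleBialgebra BH.circ hA act) (b : A)
    (v : A ⊗[k] H) :
    smashRight act BH.circ.mul (leftMul H hA.mul (b ⊗ₜ v)) =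
      conv (leftMul H hA.mul) (act ∘ₗ (TensorProduct.mk k H A).flip b)
        (smashRight act BH.circ.mul v) := by
  induction v with
  | zero => simp only [TensorProduct.tmul_zero, map_zero, smashRight_zero, conv_zero_right]
  | add v w hv hw =>
    simp only [TensorProduct.tmul_add, map_add, smashRight_add, conv_add_right, hv, hw]
  | tmul c z =>
    have hact : act ∘ₗ (TensorProduct.mk k H A).flip (hA.mul (b ⊗ₜ c)) =
        conv hA.mul (act ∘ₗ (TensorProduct.mk k H A).flip b)
          (act ∘ₗ (TensorProduct.mk k H A).flip c) := by
      ext x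
      refine (hmb.toLaw.act_mul x b c).trans (congrArg hA.mul ?_)
      rw [LinearMap.comp_apply]
      generalize Coalgebra.comul (R := k) x = t
      induction t with
      | zero => simp
      | add t₁ t₂ h₁ h₂ => simp only [TensorProduct.add_tmul, map_add, h₁, h₂]
      | tmul y z => simp
    rw [leftMul_tmul, smashRight_tmul, smashRight_tmul, hact]
    exact conv_assoc (fun _ _ _ => rfl) _ _ _

theorem smashRight_rightMul (act : H ⊗[k] A →ₗ[k] A) (BH : HopfBrace k H) (v : A ⊗[k] H) (z : H) :
    smashRight act BH.circ.mul (rightMul A BH.dot.mul (v ⊗ₜ z)) =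
      conv (rightMul A BH.dot.mul) (smashRight act BH.circ.mul v)
        (conv BH.dot.mul BH.dot.antipode (BH.circ.mul ∘ₗ (TensorProduct.mk k H H).flip z)) := by
  induction v with
  | zero => simp only [TensorProduct.zero_tmul, map_zero, smashRight_zero, conv_zero_left]
  | add v w hv hw =>
    simp only [TensorProduct.add_tmul, map_add, smashRight_add, conv_add_left, hv, hw]
  | tmul c y =>
    rw [rightMul_tmul, smashRight_tmul, smashRight_tmul, BH.circ_mul]
    exact (conv_assoc (fun _ _ _ => rfl) _ _ _).symm

theorem rightMul_comp_rTensor_matchedMap (act : H ⊗[k] A →ₗ[k] A) (mH : H ⊗[k] H →ₗ[k] H) :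
    rightMul A mH ∘ₗ rTensor H (matchedMap act (projLeft H A)) ∘ₗ
        (TensorProduct.assoc k H A H).symm.toLinearMap =
      conv LinearMap.id (act ∘ₗ lTensor H (projLeft A H)) (mH ∘ₗ lTensor H (projRight A H)) := by
  have h := conv_projLeft_rTensor LinearMap.id act mH (projLeft H A) (D := H)
  have hl : act ∘ₗ projLeft (H ⊗[k] A) H = (act ∘ₗ lTensor H (projLeft A H)) ∘ₗ
      (TensorProduct.assoc k H A H).toLinearMap := by
    ext; simp
  have hr : mH ∘ₗ rTensor H (projLeft H A) = (mH ∘ₗ lTensor H (projRight A H)) ∘ₗ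
      (TensorProduct.assoc k H A H).toLinearMap := by
    ext; simp [TensorProduct.smul_tmul]
  rw [hl, hr, conv_comp_coalgMap _ _ _ isCoalgMap_assoc] at h
  refine LinearMap.ext fun t => ?_
  have := LinearMap.congr_fun h ((TensorProduct.assoc k H A H).symm t)
  simp only [LinearMap.comp_apply, LinearEquiv.coe_coe, LinearEquiv.apply_symm_apply] at this ⊢
  exact this.symm

theorem smashRight_matchedMap (hV : IsCocomm k H) (hmp : IsMatchedPair hA BH.dot tri quad)
    (hact : IsCoalgMap act)
    (h21 : (act ∘ₗ lTensor H tri) ∘ₗ (TensorProduct.assoc k H H A).toLinearMap =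
      tri ∘ₗ BH.twistMap act)
    (h22 : (BH.circ.mul ∘ₗ lTensor H quad) ∘ₗ (TensorProduct.assoc k H H A).toLinearMap =
      conv BH.dot.mul (quad ∘ₗ BH.twistMap act) (projLeft H H ∘ₗ projLeft (H ⊗[k] H) A))
    (y : H) (c : A) :
    smashRight act BH.circ.mul (matchedMap tri quad (y ⊗ₜ c)) =
      conv (rightMul A BH.dot.mul)
        (conv (matchedMap tri quad)
          (conv BH.dot.mul (BH.circ.mul ∘ₗ (TensorProduct.mk k H H).flip y) BH.dot.antipode)
          (act ∘ₗ (TensorProduct.mk k H A).flip c)) LinearMap.id := by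
  have hR : IsCoalgMap (lTensor H (matchedMap tri quad)) :=
    IsCoalgMap.id.map hmp.isCoalgMap_matchedMap
  have key : (rightMul A BH.circ.mul ∘ₗ rTensor H (matchedMap act (projLeft H A)) ∘ₗ
        (TensorProduct.assoc k H A H).symm.toLinearMap) ∘ₗ lTensor H (matchedMap tri quad) ∘ₗ
        (TensorProduct.assoc k H H A).toLinearMap =
      conv (rightMul A BH.dot.mul) (matchedMap tri quad ∘ₗ BH.twistMap act)
        (projLeft H H ∘ₗ projLeft (H ⊗[k] H) A) := by
    rw [rightMul_comp_rTensor_matchedMap, ← LinearMap.comp_assoc,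
      ← conv_comp_coalgMap _ _ _ hR, LinearMap.comp_assoc, LinearMap.comp_assoc,
      ← lTensor_comp, ← lTensor_comp, matchedMap, projLeft_comp_conv hmp.quad_coalg.isCoalgMap,
      projRight_comp_conv hmp.tri_coalg.isCoalgMap,
      ← conv_comp_coalgMap _ _ _ isCoalgMap_assoc, h21, h22,
      ← conv_assoc (m₁ := rightMul A BH.dot.mul) (m₂ := LinearMap.id) (fun _ _ _ => rfl),
      conv_comp_coalgMap _ _ _ (BH.isCoalgMap_twistMap hV hact)]
  ext x
  refine (LinearMap.congr_fun key ((x ⊗ₜ y) ⊗ₜ c)).trans ?_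
  rw [conv_projLeft_right, ← LinearMap.id_comp (projLeft H H), conv_projLeft_right]
  congr 2
  ext z
  exact congrArg (matchedMap tri quad) (BH.twistMap_tmul act z y c)

theorem bicrossedMul_projLeft (act : H ⊗[k] A →ₗ[k] A) (mA : A ⊗[k] A →ₗ[k] A)
    (mH : H ⊗[k] H →ₗ[k] H) (a : A) (x : H) (w : A ⊗[k] H) :
    bicrossedMul mA mH act (projLeft H A) ((a ⊗ₜ x) ⊗ₜ w) =
      leftMul H mA (a ⊗ₜ smashRight act mH w x) := by
  induction w with
  | zero => simp [smashRight_zero]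
  | add v w hv hw =>
    simp only [TensorProduct.tmul_add, map_add, smashRight_add, LinearMap.add_apply, hv, hw]
  | tmul b y =>
    rw [bicrossedMul_tmul, sandwich_eq, ← leftMul_rightMul]
    rfl

/-- Right multiplication by `w` in the smash product `A # H_∘`, in terms of its restriction to `H`
and the multiplication of a bicrossed product. -/
theorem bicrossedMul_projLeft_comp_flip (hmp : IsMatchedPair hA BH.dot tri quad)
    (act : H ⊗[k] A →ₗ[k] A) (mH : H ⊗[k] H →ₗ[k] H) (w : A ⊗[k] H) :
    bicrossedMul hA.mul mH act (projLeft H A) ∘ₗ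
        (TensorProduct.mk k (A ⊗[k] H) (A ⊗[k] H)).flip w =
      conv (bicrossedMul hA.mul BH.dot.mul tri quad) (inclLeft A BH.dot ∘ₗ projLeft A H)
        (smashRight act mH w ∘ₗ projRight A H) := by
  rw [conv_projLeft_projRight]
  ext a x
  simp [bicrossedMul_projLeft, hmp.mul_inclLeft_left]

theorem conv_leftMul (hmp : IsMatchedPair hA BH.dot tri quad) {C : Type u} [AddCommGroup C]
    [Module k C] [Coalgebra k C] (f : C →ₗ[k] A) (g : C →ₗ[k] A ⊗[k] H) :
    conv (leftMul H hA.mul) f g =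
      conv (bicrossedMul hA.mul BH.dot.mul tri quad) (inclLeft A BH.dot ∘ₗ f) g := by
  rw [conv_comp_left]
  congr 1
  exact TensorProduct.ext' fun a v => (hmp.mul_inclLeft_left a v).symm

theorem conv_rightMul (hmp : IsMatchedPair hA BH.dot tri quad) {C : Type u} [AddCommGroup C]
    [Module k C] [Coalgebra k C] (f : C →ₗ[k] A ⊗[k] H) (g : C →ₗ[k] H) :
    conv (rightMul A BH.dot.mul) f g =
      conv (bicrossedMul hA.mul BH.dot.mul tri quad) f (inclRight H hA ∘ₗ g) := by
  rw [conv_comp_right]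
  congr 1
  exact TensorProduct.ext' fun v y => (hmp.mul_inclRight_right v y).symm

theorem conv_matchedMap (tri : H ⊗[k] A →ₗ[k] A) (quad : H ⊗[k] A →ₗ[k] H) {C : Type u}
    [AddCommGroup C] [Module k C] [Coalgebra k C] (f : C →ₗ[k] H) (g : C →ₗ[k] A) :
    conv (matchedMap tri quad) f g =
      conv (bicrossedMul hA.mul BH.dot.mul tri quad) (inclRight H hA ∘ₗ f)
        (inclLeft A BH.dot ∘ₗ g) := by
  have h : bicrossedMul hA.mul BH.dot.mul tri quad ∘ₗ
      TensorProduct.map (inclRight H hA) (inclLeft A BH.dot) = matchedMap tri quad :=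
    TensorProduct.ext' fun x a => IsMatchedPair.mul_inclRight_inclLeft tri quad x a
  rw [conv_comp_comp, h]

theorem smashRight_tmul_eq_conv (hmp : IsMatchedPair hA BH.dot tri quad)
    (act : H ⊗[k] A →ₗ[k] A) (mH : H ⊗[k] H →ₗ[k] H) (c : A) (z : H) :
    smashRight act mH (c ⊗ₜ z) = conv (bicrossedMul hA.mul BH.dot.mul tri quad)
      (inclLeft A BH.dot ∘ₗ act ∘ₗ (TensorProduct.mk k H A).flip c)
      (inclRight H hA ∘ₗ mH ∘ₗ (TensorProduct.mk k H H).flip z) := by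
  have h : bicrossedMul hA.mul BH.dot.mul tri quad ∘ₗ
      TensorProduct.map (inclLeft A BH.dot) (inclRight H hA) = LinearMap.id :=
    TensorProduct.ext' fun a x => by
      simp [hmp.matchedMap_one_tmul, hA.mul_one, BH.dot.one_mul]
  rw [smashRight_tmul, conv_comp_comp _ (inclLeft A BH.dot) (inclRight H hA), h]

theorem smashRight_mul (hV : IsCocomm k H) (hmp : IsMatchedPair hA BH.dot tri quad)
    (hmb : IsLeftModuleBialgebra BH.circ hA act)
    (h21 : (act ∘ₗ lTensor H tri) ∘ₗ (TensorProduct.assoc k H H A).toLinearMap =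
      tri ∘ₗ BH.twistMap act)
    (h22 : (BH.circ.mul ∘ₗ lTensor H quad) ∘ₗ (TensorProduct.assoc k H H A).toLinearMap =
      conv BH.dot.mul (quad ∘ₗ BH.twistMap act) (projLeft H H ∘ₗ projLeft (H ⊗[k] H) A))
    (b c : A) (y z : H) :
    smashRight act BH.circ.mul
        (bicrossedMul hA.mul BH.dot.mul tri quad ((b ⊗ₜ y) ⊗ₜ (c ⊗ₜ z))) =
      conv (bicrossedMul hA.mul BH.dot.mul tri quad) (smashRight act BH.circ.mul (b ⊗ₜ y))
        (conv (bicrossedMul hA.mul BH.dot.mul tri quad) (inclRight H hA ∘ₗ BH.dot.antipode)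
          (smashRight act BH.circ.mul (c ⊗ₜ z))) := by
  have hι : conv (bicrossedMul hA.mul BH.dot.mul tri quad) (inclRight H hA ∘ₗ LinearMap.id)
      (inclRight H hA ∘ₗ BH.dot.antipode) = counitMap H (hA.one ⊗ₜ[k] BH.dot.one) := by
    rw [hmp.conv_inclRight, BH.dot.conv_antipode_right, comp_counitMap, inclRight_apply]
  have as := fun e f g : H →ₗ[k] A ⊗[k] H => conv_assoc hmp.mul_assoc e f g
  rw [bicrossedMul_tmul, sandwich_eq, ← leftMul_rightMul, smashRight_leftMul hmb,
    smashRight_rightMul, smashRight_matchedMap hV hmp hmb.toCoalgLaw.isCoalgMap h21 h22,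
    conv_leftMul hmp, conv_rightMul hmp, conv_rightMul hmp, conv_matchedMap (hA := hA) (BH := BH),
    ← hmp.conv_inclRight, ← hmp.conv_inclRight, smashRight_tmul_eq_conv hmp,
    smashRight_tmul_eq_conv hmp]
  simp only [as]
  rw [← as (inclRight H hA ∘ₗ LinearMap.id), hι,
    conv_counitMap_left (p := LinearMap.id) hmp.one_mul, LinearMap.id_comp]

theorem brace_bicrossed (hV : IsCocomm k H) (hmp : IsMatchedPair hA BH.dot tri quad)
    (hmb : IsLeftModuleBialgebra BH.circ hA act)
    (h21 : (act ∘ₗ lTensor H tri) ∘ₗ (TensorProduct.assoc k H H A).toLinearMap =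
      tri ∘ₗ BH.twistMap act)
    (h22 : (BH.circ.mul ∘ₗ lTensor H quad) ∘ₗ (TensorProduct.assoc k H H A).toLinearMap =
      conv BH.dot.mul (quad ∘ₗ BH.twistMap act) (projLeft H H ∘ₗ projLeft (H ⊗[k] H) A)) :
    (hmb.isMatchedPair hV).bicrossed.mul ∘ₗ lTensor (A ⊗[k] H) hmp.bicrossed.mul =
      braceRHS hmp.bicrossed.mul hmp.bicrossed.antipode (hmb.isMatchedPair hV).bicrossed.mul := by
  refine TensorProduct.ext' fun p q => ?_
  induction q with
  | zero => simp only [TensorProduct.tmul_zero, map_zero]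
  | add q₁ q₂ h₁ h₂ => simp only [TensorProduct.tmul_add, map_add, h₁, h₂]
  | tmul w w' =>
  induction w with
  | zero => simp only [TensorProduct.tmul_zero, TensorProduct.zero_tmul, map_zero]
  | add q₁ q₂ h₁ h₂ => simp only [TensorProduct.tmul_add, TensorProduct.add_tmul, map_add, h₁, h₂]
  | tmul b y =>
  induction w' with
  | zero => simp only [TensorProduct.tmul_zero, map_zero]
  | add q₁ q₂ h₁ h₂ => simp only [TensorProduct.tmul_add, map_add, h₁, h₂]
  | tmul c z =>
  have hS : conv (bicrossedMul hA.mul BH.dot.mul tri quad)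
      (inclLeft A BH.dot ∘ₗ hA.antipode ∘ₗ projLeft A H) (inclLeft A BH.dot ∘ₗ projLeft A H) =
      counitMap (A ⊗[k] H) (hA.one ⊗ₜ[k] BH.dot.one) := by
    have h : conv hA.mul (hA.antipode ∘ₗ projLeft A H) (projLeft A H) =
        counitMap (A ⊗[k] H) hA.one := by
      rw [← counitMap_comp_coalgMap _ isCoalgMap_projLeft, ← hA.conv_antipode_left]
      exact conv_comp_coalgMap _ _ LinearMap.id isCoalgMap_projLeft
    rw [hmp.conv_inclLeft, h, comp_counitMap, inclLeft_apply]
  have as := fun e f g : A ⊗[k] H →ₗ[k] A ⊗[k] H => conv_assoc hmp.mul_assoc e f g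
  have key : bicrossedMul hA.mul BH.circ.mul act (projLeft H A) ∘ₗ
        (TensorProduct.mk k (A ⊗[k] H) (A ⊗[k] H)).flip
          (bicrossedMul hA.mul BH.dot.mul tri quad ((b ⊗ₜ y) ⊗ₜ (c ⊗ₜ z))) =
      conv (bicrossedMul hA.mul BH.dot.mul tri quad)
        (bicrossedMul hA.mul BH.circ.mul act (projLeft H A) ∘ₗ
          (TensorProduct.mk k (A ⊗[k] H) (A ⊗[k] H)).flip (b ⊗ₜ y))
        (conv (bicrossedMul hA.mul BH.dot.mul tri quad) hmp.antipode
          (bicrossedMul hA.mul BH.circ.mul act (projLeft H A) ∘ₗ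
            (TensorProduct.mk k (A ⊗[k] H) (A ⊗[k] H)).flip (c ⊗ₜ z))) := by
    rw [bicrossedMul_projLeft_comp_flip hmp, bicrossedMul_projLeft_comp_flip hmp,
      bicrossedMul_projLeft_comp_flip hmp, smashRight_mul hV hmp hmb h21 h22,
      ← conv_comp_coalgMap _ _ _ isCoalgMap_projRight,
      ← conv_comp_coalgMap _ _ _ isCoalgMap_projRight, IsMatchedPair.antipode]
    simp only [as]
    rw [← as (inclLeft A BH.dot ∘ₗ hA.antipode ∘ₗ projLeft A H), hS,
      conv_counitMap_left (p := LinearMap.id) hmp.one_mul, LinearMap.id_comp]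
    rfl
  rw [braceRHS_tmul]
  exact LinearMap.congr_fun key p

end Brace

/-- Theorem `main`. Let `A` be a Hopf algebra and `(H, ·, ∘)` a cocommutative
Hopf brace. If `(A, H, ▷, ◁)` is a matched pair of Hopf algebras (w.r.t. `·`), `(A, ▶)` is a
left `H∘`-module bialgebra, and
`x ▶ (x' ▷ a) = ((x₍₁₎ ∘ x')·S(x₍₂₎)) ▷ (x₍₃₎ ▶ a)` and
`x ∘ (x' ◁ a) = (((x₍₁₎ ∘ x')·S(x₍₂₎)) ◁ (x₍₃₎ ▶ a))·x₍₄₎`, then the tensor product coalgebra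
`A ⊗ H` with `(a ⊗ x)(b ⊗ y) = a(x₍₁₎ ▷ b₍₁₎) ⊗ (x₍₂₎ ◁ b₍₂₎)·y` and
`(a ⊗ x) ∘ (b ⊗ y) = a(x₍₁₎ ▶ b) ⊗ x₍₂₎ ∘ y` is a Hopf brace. -/
theorem statement3 {k : Type u} [Field k]
    {A H : Type u} [AddCommGroup A] [Module k A] [Coalgebra k A]
    [AddCommGroup H] [Module k H] [Coalgebra k H]
    (hA : HopfStr k A) (BH : HopfBrace k H) (hHcocomm : IsCocomm k H)
    (tri : H ⊗[k] A →ₗ[k] A) (quad : H ⊗[k] A →ₗ[k] H)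
    (act : H ⊗[k] A →ₗ[k] A)
    (hmp : IsMatchedPair hA BH.dot tri quad)
    (hmb : IsLeftModuleBialgebra BH.circ hA act)
    (h21 : ∀ (x x' : H) (a : A),
      act (x ⊗ₜ[k] tri (x' ⊗ₜ[k] a)) =
        tri (TensorProduct.map
          (BH.dot.mul ∘ₗ TensorProduct.map
            (BH.circ.mul ∘ₗ (TensorProduct.mk k H H).flip x') BH.dot.antipode)
          (act ∘ₗ (TensorProduct.mk k H A).flip a)
          (rTensor H (Coalgebra.comul (R := k)) (Coalgebra.comul (R := k) x))))
    (h22 : ∀ (x x' : H) (a : A),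
      BH.circ.mul (x ⊗ₜ[k] quad (x' ⊗ₜ[k] a)) =
        BH.dot.mul (rTensor H quad ((TensorProduct.assoc k H A H).symm
          (TensorProduct.map
            (BH.dot.mul ∘ₗ TensorProduct.map
              (BH.circ.mul ∘ₗ (TensorProduct.mk k H H).flip x') BH.dot.antipode)
            (rTensor H (act ∘ₗ (TensorProduct.mk k H A).flip a))
            (lTensor (H ⊗[k] H) (Coalgebra.comul (R := k))
              (rTensor H (Coalgebra.comul (R := k)) (Coalgebra.comul (R := k) x))))))) :
    ∃ B : HopfBrace k (A ⊗[k] H),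
      (∀ (a b : A) (x y : H),
        B.dot.mul ((a ⊗ₜ[k] x) ⊗ₜ[k] (b ⊗ₜ[k] y)) =
          sandwich k hA.mul BH.dot.mul ((a ⊗ₜ[k] matchedEl tri quad x b) ⊗ₜ[k] y)) ∧
      (∀ (a b : A) (x y : H),
        B.circ.mul ((a ⊗ₜ[k] x) ⊗ₜ[k] (b ⊗ₜ[k] y)) =
          sandwich k hA.mul BH.circ.mul ((a ⊗ₜ[k] smashEl act x b) ⊗ₜ[k] y)) := by
  refine ⟨⟨hmp.bicrossed, (hmb.isMatchedPair hHcocomm).bicrossed,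
    brace_bicrossed hHcocomm hmp hmb (act_comp_lTensor h21) (circ_mul_comp_lTensor h22)⟩,
    fun a b x y => rfl, fun a b x y => ?_⟩
  rw [← matchedMap_projLeft_eq_smashEl]
  rfl

end HopfBraceNL
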